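/- For all integers k, l ≥ 0, every function F : ℂ^m × ℂ^r → ℂ, and every point (x, y) ∈ ℂ^m × ℂ^r that is admissible for the identity (i.e. every bracket value occurring in a denominator of any coefficient of either iterated sum is nonzero), the deformed elliptic Ruijsenaars operators commute: (H_{m,r}^{(k)} (H_{m,r}^{(l)} F))(x; y) = (H_{m,r}^{(l)} (H_{m,r}^{(k)} F))(x; y). -/

import Mathlib

open Finset

/-- Shifted factorial `[x; a]_k` for `k ∈ ℤ`:
`[x; a]_k = [x][x+a]⋯[x+(k-1)a]` for `k ≥ 0` and `[x; a]_{-k} = 1/[x-ka; a]_k`. -/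
noncomputable def sfac (br : ℂ → ℂ) (a x : ℂ) (k : ℤ) : ℂ :=
  if 0 ≤ k then ∏ i ∈ Finset.range k.toNat, br (x + (i : ℂ) * a)
  else (∏ i ∈ Finset.range (-k).toNat, br (x + ((k : ℂ) + (i : ℂ)) * a))⁻¹

/-- The coefficient `C_{μ,I}(x; y; a, b)`. -/
noncomputable def Coef (br : ℂ → ℂ) (a b : ℂ) {m r : ℕ} (μ : Fin m → ℕ)
    (I : Finset (Fin r)) (x : Fin m → ℂ) (y : Fin r → ℂ) : ℂ :=
  (-1 : ℂ) ^ I.card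
    * (∏ i : Fin m, ∏ j : Fin m,
        if i < j then br (x i - x j + ((μ i : ℂ) - (μ j : ℂ)) * a) / br (x i - x j) else 1)
    * (∏ i ∈ I, ∏ j ∈ Iᶜ, br (y i - y j - a) / br (y i - y j))
    * (∏ i : Fin m, ∏ j : Fin m,
        sfac br a (x i - x j + b) (μ i : ℤ) / sfac br a (x i - x j + a) (μ i : ℤ))
    * ∏ i : Fin m,
        ((∏ j ∈ I, br (x i - y j - b) / br (x i - y j + (μ i : ℂ) * a))
          * ∏ j ∈ Iᶜ, br (x i - y j - a) / br (x i - y j + ((μ i : ℂ) - 1) * a))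

/-- Index set of the sums: pairs `(μ, I)` with `μ ∈ ℤ_{≥0}^m`, `I ⊆ {1,…,r}`, `|μ|+|I| = k`. -/
def idxSet (m r k : ℕ) : Finset ((Fin m → ℕ) × Finset (Fin r)) :=
  ((Fintype.piFinset fun _ : Fin m => Finset.range (k + 1)) ×ˢ
      (Finset.univ : Finset (Finset (Fin r)))).filter
    fun p => (∑ i, p.1 i) + p.2.card = k

def xshift (c : ℂ) {m : ℕ} (μ : Fin m → ℕ) (x : Fin m → ℂ) : Fin m → ℂ :=
  fun i => x i + c * (μ i : ℂ)

def xshiftI (c : ℂ) {m : ℕ} (I : Finset (Fin m)) (x : Fin m → ℂ) : Fin m → ℂ :=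
  fun i => x i + c * (if i ∈ I then 1 else 0)

def yshift (c : ℂ) {r : ℕ} (I : Finset (Fin r)) (y : Fin r → ℂ) : Fin r → ℂ :=
  fun j => y j - c * (if j ∈ I then 1 else 0)

def yshiftMu (c : ℂ) {r : ℕ} (μ : Fin r → ℕ) (y : Fin r → ℂ) : Fin r → ℂ :=
  fun j => y j - c * (μ j : ℂ)

/-- The deformed elliptic Ruijsenaars operator `H_{m,r}^{(k)}`. -/
noncomputable def Hop (br : ℂ → ℂ) (δ κ : ℂ) (m r k : ℕ)
    (F : (Fin m → ℂ) → (Fin r → ℂ) → ℂ) (x : Fin m → ℂ) (y : Fin r → ℂ) : ℂ :=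
  ∑ p ∈ idxSet m r k, Coef br δ κ p.1 p.2 x y * F (xshift δ p.1 x) (yshift κ p.2 y)

/-- The operator `D_{m,r}^{(k)}`. -/
noncomputable def Dop (br : ℂ → ℂ) (δ κ : ℂ) (m r k : ℕ)
    (F : (Fin m → ℂ) → (Fin r → ℂ) → ℂ) (x : Fin m → ℂ) (y : Fin r → ℂ) : ℂ :=
  ∑ p ∈ idxSet r m k, Coef br (-κ) (-δ) p.1 p.2 y x * F (xshiftI δ p.2 x) (yshiftMu κ p.1 y)

/-- The operator `Ĥ_{m,r}^{(k)}`. -/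
noncomputable def Hhat (br : ℂ → ℂ) (δ κ : ℂ) (m r k : ℕ)
    (F : (Fin m → ℂ) → (Fin r → ℂ) → ℂ) (x : Fin m → ℂ) (y : Fin r → ℂ) : ℂ :=
  ∑ p ∈ idxSet m r k,
    Coef br (-δ) (-κ) p.1 p.2 (fun i => x i - δ) (fun j => y j + κ)
      * F (xshift (-δ) p.1 x) (yshift (-κ) p.2 y)

/-- The operator `D̂_{m,r}^{(k)}`. -/
noncomputable def Dhat (br : ℂ → ℂ) (δ κ : ℂ) (m r k : ℕ)
    (F : (Fin m → ℂ) → (Fin r → ℂ) → ℂ) (x : Fin m → ℂ) (y : Fin r → ℂ) : ℂ :=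
  ∑ p ∈ idxSet r m k,
    Coef br κ δ p.1 p.2 (fun j => y j + κ) (fun i => x i - δ)
      * F (xshiftI (-δ) p.2 x) (yshiftMu (-κ) p.1 y)

/-- Nonvanishing of all bracket values occurring in denominators of `C_{μ,I}(x; y; a, b)`. -/
def CDenomNZ (br : ℂ → ℂ) (a : ℂ) {m r : ℕ} (μ : Fin m → ℕ)
    (I : Finset (Fin r)) (x : Fin m → ℂ) (y : Fin r → ℂ) : Prop :=
  (∀ i j : Fin m, i < j → br (x i - x j) ≠ 0)
    ∧ (∀ i ∈ I, ∀ j ∈ Iᶜ, br (y i - y j) ≠ 0)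
    ∧ (∀ i j : Fin m, sfac br a (x i - x j + a) (μ i : ℤ) ≠ 0)
    ∧ (∀ i : Fin m, ∀ j ∈ I, br (x i - y j + (μ i : ℂ) * a) ≠ 0)
    ∧ (∀ i : Fin m, ∀ j ∈ Iᶜ, br (x i - y j + ((μ i : ℂ) - 1) * a) ≠ 0)

/-- An odd entire function, not identically zero, that satisfies the three-term relation. -/
structure IsBracket (br : ℂ → ℂ) : Prop where
  odd : ∀ z, br (-z) = -br z
  diff : Differentiable ℂ br
  ne_zero : br ≠ 0
  three_term : ∀ a b c d : ℂ,
    br (a + b) * br (a - b) * br (c + d) * br (c - d)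
      + br (a + d) * br (a - d) * br (b + c) * br (b - c)
      = br (a + c) * br (a - c) * br (b + d) * br (b - d)

theorem exists_of_residual {p : ℂ → Prop} (h : ∀ᶠ t in residual ℂ, p t) : ∃ t, p t :=
  (dense_of_mem_residual h).nonempty

namespace IsBracket

variable {br : ℂ → ℂ}

theorem zero (h : IsBracket br) : br 0 = 0 := by
  have := h.odd 0
  rw [neg_zero] at this
  exact self_eq_neg.mp this

/-- A nonconstant affine function avoids the zeros of a bracket at generic points. -/
theorem eventually_ne (h : IsBracket br) (α : ℂ) {β : ℂ} (hβ : β ≠ 0) :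
    ∀ᶠ t in residual ℂ, br (α + t * β) ≠ 0 := by
  have hd : Differentiable ℂ fun t : ℂ => br (α + t * β) :=
    h.diff.comp (by fun_prop)
  refine residual_of_dense_open (isOpen_ne_fun hd.continuous continuous_const) ?_
  intro t
  rw [mem_closure_iff_frequently]
  have ht := (hd.analyticAt t).eventually_eq_zero_or_eventually_ne_zero
  rcases ht with ht | ht
  · exfalso
    apply h.ne_zero
    have han : AnalyticOnNhd ℂ (fun t : ℂ => br (α + t * β)) Set.univ :=
      fun s _ => hd.analyticAt s
    have hz := han.eq_of_eventuallyEq (g := fun _ => 0) (fun s _ => analyticAt_const) ht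
    funext z
    have := congrFun hz ((z - α) / β)
    simpa [div_mul_cancel₀ _ hβ] using this
  · exact ht.frequently.filter_mono nhdsWithin_le_nhds

/-- Any three of the products `[z - a][z - s + a]` with fixed `s` are linearly dependent. -/
theorem reduce (h : IsBracket br) (z a p b s : ℂ) (h₁ : br (p - b) ≠ 0)
    (h₂ : br (p + b - s) ≠ 0) :
    br (z - a) * br (z - s + a)
      = br (a + b - s) * br (a - b) / (br (p - b) * br (p + b - s))
          * (br (z - p) * br (z - s + p))
        - br (a + p - s) * br (a - p) / (br (p - b) * br (p + b - s))
          * (br (z - b) * br (z - s + b)) := by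
  have := h.three_term (z - s / 2) (a - s / 2) (p - s / 2) (b - s / 2)
  rw [show z - s / 2 + (a - s / 2) = z - s + a by ring,
    show z - s / 2 - (a - s / 2) = z - a by ring,
    show p - s / 2 + (b - s / 2) = p + b - s by ring,
    show p - s / 2 - (b - s / 2) = p - b by ring,
    show z - s / 2 + (b - s / 2) = z - s + b by ring,
    show z - s / 2 - (b - s / 2) = z - b by ring,
    show a - s / 2 + (p - s / 2) = a + p - s by ring,
    show a - s / 2 - (p - s / 2) = a - p by ring,
    show z - s / 2 + (p - s / 2) = z - s + p by ring,
    show z - s / 2 - (p - s / 2) = z - p by ring,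
    show a - s / 2 + (b - s / 2) = a + b - s by ring,
    show a - s / 2 - (b - s / 2) = a - b by ring] at this
  rw [div_mul_eq_mul_div, div_mul_eq_mul_div, ← sub_div, eq_div_iff (mul_ne_zero h₁ h₂)]
  linear_combination this

end IsBracket

/-- The function `z ↦ ∏_{a ∈ s} [z - a]`. -/
noncomputable def thetaProd (br : ℂ → ℂ) (s : Multiset ℂ) (z : ℂ) : ℂ :=
  (s.map fun a => br (z - a)).prod

/-- The span of the products `∏_{a ∈ s} [z - a]` over the multisets `s` of cardinality `n`
and sum `t`. -/
noncomputable def thetaSpace (br : ℂ → ℂ) (n : ℕ) (t : ℂ) : Submodule ℂ (ℂ → ℂ) :=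
  Submodule.span ℂ {g | ∃ s : Multiset ℂ, s.card = n ∧ s.sum = t ∧ g = thetaProd br s}

section thetaSpace

variable {br : ℂ → ℂ}

theorem thetaProd_mem (br : ℂ → ℂ) (s : Multiset ℂ) :
    thetaProd br s ∈ thetaSpace br s.card s.sum :=
  Submodule.subset_span ⟨s, rfl, rfl, rfl⟩

theorem thetaProd_cons (a : ℂ) (s : Multiset ℂ) (z : ℂ) :
    thetaProd br (a ::ₘ s) z = br (z - a) * thetaProd br s z := by
  simp [thetaProd]

theorem thetaProd_add (s s' : Multiset ℂ) (z : ℂ) :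
    thetaProd br (s + s') z = thetaProd br s z * thetaProd br s' z := by
  simp [thetaProd]

theorem thetaProd_sum {ι : Type*} (A : Finset ι) (s : ι → Multiset ℂ) (z : ℂ) :
    thetaProd br (∑ i ∈ A, s i) z = ∏ i ∈ A, thetaProd br (s i) z := by
  classical
  induction A using Finset.induction_on with
  | empty => simp [thetaProd]
  | insert i A hi ih => rw [sum_insert hi, prod_insert hi, thetaProd_add, ih]

theorem mul_mem_thetaSpace {n : ℕ} {t : ℂ} (a : ℂ) {g : ℂ → ℂ} (hg : g ∈ thetaSpace br n t) :
    (fun z => br (z - a) * g z) ∈ thetaSpace br (n + 1) (t + a) := by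
  induction hg using Submodule.span_induction with
  | mem g hg =>
    obtain ⟨s, rfl, rfl, rfl⟩ := hg
    refine Submodule.subset_span ⟨a ::ₘ s, by simp, by simp [add_comm], ?_⟩
    funext z
    rw [thetaProd_cons]
  | zero =>
    convert Submodule.zero_mem _ using 1
    funext z
    simp
  | add g g' _ _ h h' =>
    convert Submodule.add_mem _ h h' using 1
    funext z
    simp [mul_add]
  | smul c g _ h =>
    convert Submodule.smul_mem _ c h using 1
    funext z
    simp [mul_left_comm]

/-- Modulo the multiples of `[z - p]`, every product reduces to a multiple of
`[z - b]^n [z - t + n b]`, for generic `b`. -/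
theorem thetaProd_reduce (h : IsBracket br) (p : ℂ) (s : Multiset ℂ) (n : ℕ)
    (hs : s.card = n + 1) :
    ∀ᶠ b in residual ℂ, ∃ g ∈ thetaSpace br n (s.sum - p), ∃ c : ℂ,
      ∀ z, thetaProd br s z
        = br (z - p) * g z + c * (br (z - b) ^ n * br (z - s.sum + n * b)) := by
  induction n generalizing s with
  | zero =>
    obtain ⟨a, rfl⟩ := Multiset.card_eq_one.mp hs
    exact Filter.Eventually.of_forall fun b =>
      ⟨0, Submodule.zero_mem _, 1, fun z => by simp [thetaProd]⟩
  | succ n ih =>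
    obtain ⟨a, s, rfl⟩ : ∃ a s', s = a ::ₘ s' := by
      obtain ⟨a, ha⟩ := Multiset.card_pos_iff_exists_mem.mp (by omega : 0 < s.card)
      exact ⟨a, s.erase a, (Multiset.cons_erase ha).symm⟩
    rw [Multiset.card_cons, add_left_inj] at hs
    have e₁ := h.eventually_ne p (β := -1) (by norm_num)
    have e₂ := h.eventually_ne (p - (a + s.sum)) (β := (n : ℂ) + 1) (by exact_mod_cast n.succ_ne_zero)
    filter_upwards [ih s hs, e₁, e₂] with b hb h₁ h₂
    obtain ⟨g, hg, c, hc⟩ := hb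
    rw [mul_neg_one, ← sub_eq_add_neg] at h₁
    have h₂' : br (p + b - (a + s.sum - n * b)) ≠ 0 := by
      convert h₂ using 2
      ring
    set α := br (a + b - (a + s.sum - n * b)) * br (a - b)
      / (br (p - b) * br (p + b - (a + s.sum - n * b)))
    set β := br (a + p - (a + s.sum - n * b)) * br (a - p)
      / (br (p - b) * br (p + b - (a + s.sum - n * b)))
    have hred : ∀ z, br (z - a) * br (z - (a + s.sum - n * b) + a) = _ :=
      fun z => h.reduce z a p b (a + s.sum - n * b) h₁ h₂'
    refine ⟨(fun z => br (z - a) * g z)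
      + (c * α) • thetaProd br (Multiset.replicate n b + {a + s.sum - n * b - p}), ?_, -c * β, ?_⟩
    · refine Submodule.add_mem _ ?_ (Submodule.smul_mem _ _ ?_)
      · convert mul_mem_thetaSpace a hg using 2
        simp
        ring
      · convert thetaProd_mem br _ using 2
        · simp
        · simp only [Multiset.sum_cons, Multiset.sum_add, Multiset.sum_replicate,
            Multiset.sum_singleton, nsmul_eq_mul]
          ring
    · intro z
      rw [thetaProd_cons, hc]
      have := hred z
      simp only [Pi.add_apply, Pi.smul_apply, smul_eq_mul, thetaProd_add]
      simp only [thetaProd, Multiset.map_replicate, Multiset.prod_replicate, Multiset.map_singleton,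
        Multiset.prod_singleton, Multiset.sum_cons]
      have e1 : z - (a + s.sum - n * b) + a = z - s.sum + n * b := by ring
      have e2 : z - (a + s.sum) + ((n + 1 : ℕ) : ℂ) * b = z - (a + s.sum - n * b) + b := by
        push_cast; ring
      have e3 : z - (a + s.sum - n * b - p) = z - (a + s.sum - n * b) + p := by ring
      rw [e1] at this
      rw [e2, e3]
      linear_combination (c * br (z - b) ^ n) * this

theorem exists_eq_mul_of_zero (h : IsBracket br) {n : ℕ} {t p : ℂ} {g : ℂ → ℂ}
    (hg : g ∈ thetaSpace br (n + 2) t) (hp : g p = 0) :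
    ∃ f ∈ thetaSpace br (n + 1) (t - p), ∀ z, g z = br (z - p) * f z := by
  have key : ∀ᶠ b in residual ℂ, ∃ f ∈ thetaSpace br (n + 1) (t - p), ∃ c : ℂ,
      ∀ z, g z = br (z - p) * f z
        + c * (br (z - b) ^ (n + 1) * br (z - t + (n + 1 : ℕ) * b)) := by
    clear hp
    induction hg using Submodule.span_induction with
    | mem g hg =>
      obtain ⟨s, hs, rfl, rfl⟩ := hg
      exact thetaProd_reduce h p s (n + 1) hs
    | zero =>
      exact Filter.Eventually.of_forall fun b => ⟨0, Submodule.zero_mem _, 0, by simp⟩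
    | add g g' _ _ ih ih' =>
      filter_upwards [ih, ih'] with b hb hb'
      obtain ⟨f, hf, c, hc⟩ := hb
      obtain ⟨f', hf', c', hc'⟩ := hb'
      refine ⟨f + f', Submodule.add_mem _ hf hf', c + c', fun z => ?_⟩
      simp only [Pi.add_apply, hc, hc']
      ring
    | smul d g _ ih =>
      filter_upwards [ih] with b hb
      obtain ⟨f, hf, c, hc⟩ := hb
      refine ⟨d • f, Submodule.smul_mem _ _ hf, d * c, fun z => ?_⟩
      simp only [Pi.smul_apply, smul_eq_mul, hc]
      ring
  have e₁ := h.eventually_ne p (β := -1) (by norm_num)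
  have e₂ := h.eventually_ne (p - t) (β := ((n + 1 : ℕ) : ℂ))
    (by exact_mod_cast n.succ_ne_zero)
  obtain ⟨b, ⟨f, hf, c, hc⟩, h₁, h₂⟩ := exists_of_residual (key.and (e₁.and e₂))
  refine ⟨f, hf, fun z => ?_⟩
  have h0 := hc p
  rw [hp, sub_self, h.zero, zero_mul, zero_add] at h0
  rw [mul_neg_one, ← sub_eq_add_neg] at h₁
  rw [mul_comm b] at h₂
  have : c = 0 := by
    rcases mul_eq_zero.mp h0.symm with h0 | h0
    · exact h0
    · exact absurd h0 (mul_ne_zero (pow_ne_zero _ h₁) h₂)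
  rw [hc z, this, zero_mul, add_zero]

/-- An element of `thetaSpace br n t` that vanishes at `n` distinct points of sum `t` is a
multiple of the corresponding product. -/
theorem exists_eq_const_mul_prod (h : IsBracket br) {ι : Type*} (A : Finset ι) (P : ι → ℂ)
    (hP : ∀ i ∈ A, ∀ j ∈ A, i ≠ j → br (P i - P j) ≠ 0) {g : ℂ → ℂ}
    (hg : g ∈ thetaSpace br A.card (∑ i ∈ A, P i)) (hz : ∀ i ∈ A, g (P i) = 0) :
    ∃ c : ℂ, ∀ z, g z = c * ∏ i ∈ A, br (z - P i) := by
  classical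
  induction A using Finset.induction_on generalizing g with
  | empty =>
    rw [card_empty, sum_empty] at hg
    induction hg using Submodule.span_induction with
    | mem g hg =>
      obtain ⟨s, hs, -, rfl⟩ := hg
      rw [Multiset.card_eq_zero] at hs
      exact ⟨1, by simp [hs, thetaProd]⟩
    | zero => exact ⟨0, by simp⟩
    | add g g' _ _ ih ih' =>
      obtain ⟨c, hc⟩ := ih (by simp)
      obtain ⟨c', hc'⟩ := ih' (by simp)
      exact ⟨c + c', fun z => by simp [hc, hc']⟩
    | smul d g _ ih =>
      obtain ⟨c, hc⟩ := ih (by simp)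
      exact ⟨d * c, fun z => by simp [hc]⟩
  | insert a A ha ih =>
    rcases A.eq_empty_or_nonempty with rfl | hA
    · simp only [insert_empty_eq, card_singleton, sum_singleton, prod_singleton] at hg ⊢
      clear hz
      induction hg using Submodule.span_induction with
      | mem g hg =>
        obtain ⟨s, hs, hs', rfl⟩ := hg
        obtain ⟨b, rfl⟩ := Multiset.card_eq_one.mp hs
        rw [Multiset.sum_singleton] at hs'
        exact ⟨1, by simp [hs', thetaProd]⟩
      | zero => exact ⟨0, by simp⟩
      | add g g' _ _ ih ih' =>
        obtain ⟨c, hc⟩ := ih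
        obtain ⟨c', hc'⟩ := ih'
        exact ⟨c + c', fun z => by simp [hc, hc', add_mul]⟩
      | smul d g _ ih =>
        obtain ⟨c, hc⟩ := ih
        exact ⟨d * c, fun z => by simp [hc, mul_assoc]⟩
    · obtain ⟨n, hn⟩ : ∃ n, A.card = n + 1 := Nat.exists_eq_succ_of_ne_zero hA.card_pos.ne'
      rw [card_insert_of_notMem ha, hn, sum_insert ha] at hg
      obtain ⟨f, hf, hgf⟩ := exists_eq_mul_of_zero h hg (hz a (mem_insert_self _ _))
      rw [add_sub_cancel_left, ← hn] at hf
      obtain ⟨c, hc⟩ := ih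
        (fun i hi j hj => hP i (mem_insert_of_mem hi) j (mem_insert_of_mem hj)) hf fun i hi => by
          have := hz i (mem_insert_of_mem hi)
          rw [hgf] at this
          refine (mul_eq_zero.mp this).resolve_left
            (hP i (mem_insert_of_mem hi) a (mem_insert_self _ _) ?_)
          rintro rfl
          exact ha hi
      refine ⟨c, fun z => ?_⟩
      rw [hgf, hc, prod_insert ha]
      ring

end thetaSpace

/-- The product of `f (z i - z j)` over `i ∈ T` and `j ∈ A \ T`. -/
noncomputable def cutProd {ι : Type*} [DecidableEq ι] (f : ℂ → ℂ) (z : ι → ℂ) (A T : Finset ι) :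
    ℂ :=
  ∏ i ∈ T, ∏ j ∈ A \ T, f (z i - z j)

/-- The sum of `cutProd` over the subsets of `A`, weighted by a function of the cardinality. -/
noncomputable def cutSum {ι : Type*} [DecidableEq ι] (f : ℂ → ℂ) (c : ℕ → ℂ) (z : ι → ℂ)
    (A : Finset ι) : ℂ :=
  ∑ T ∈ A.powerset, c T.card * cutProd f z A T

/-- The numerator of `cutSum` over `insert a A` with respect to the variable attached to `a`. -/
noncomputable def cutNumer {ι : Type*} [DecidableEq ι] (f : ℂ → ℂ) (c : ℕ → ℂ) (z : ι → ℂ)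
    (A : Finset ι) (d p q : ι → ℂ) : ℂ :=
  ∑ T ∈ A.powerset, cutProd f z A T *
    (c (T.card + 1) * ((∏ i ∈ T, d i) * ∏ j ∈ A \ T, p j)
      + c T.card * ((∏ i ∈ T, q i) * ∏ j ∈ A \ T, d j))

section cut

variable {ι : Type*} [DecidableEq ι] {f : ℂ → ℂ} {c : ℕ → ℂ} {z : ι → ℂ} {A T : Finset ι} {a : ι}

theorem cutProd_congr {z' : ι → ℂ} (hT : T ⊆ A) (h : ∀ i ∈ A, z i = z' i) :
    cutProd f z A T = cutProd f z' A T := by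
  refine prod_congr rfl fun i hi => prod_congr rfl fun j hj => ?_
  rw [h i (hT hi), h j (mem_sdiff.mp hj).1]

theorem cutSum_congr {z' : ι → ℂ} (h : ∀ i ∈ A, z i = z' i) :
    cutSum f c z A = cutSum f c z' A :=
  sum_congr rfl fun _ hT => by rw [cutProd_congr (mem_powerset.mp hT) h]

theorem cutProd_insert_left (ha : a ∉ A) (hT : T ⊆ A) :
    cutProd f z (insert a A) T = cutProd f z A T * ∏ i ∈ T, f (z i - z a) := by
  have haT : a ∉ T := fun h => ha (hT h)
  unfold cutProd
  rw [← prod_mul_distrib]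
  refine prod_congr rfl fun i _ => ?_
  rw [insert_sdiff_of_notMem _ haT, prod_insert (fun h => ha (mem_sdiff.mp h).1), mul_comm]

theorem cutProd_insert_insert (ha : a ∉ A) (hT : T ⊆ A) :
    cutProd f z (insert a A) (insert a T)
      = cutProd f z A T * ∏ j ∈ A \ T, f (z a - z j) := by
  have haT : a ∉ T := fun h => ha (hT h)
  unfold cutProd
  rw [insert_sdiff_insert, sdiff_insert_of_notMem ha, prod_insert haT, mul_comm]

theorem cutSum_insert_mul (ha : a ∉ A) {d p q : ι → ℂ}
    (hp : ∀ j ∈ A, f (z a - z j) * d j = p j) (hq : ∀ j ∈ A, f (z j - z a) * d j = q j) :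
    cutSum f c z (insert a A) * ∏ j ∈ A, d j = cutNumer f c z A d p q := by
  unfold cutSum cutNumer
  rw [sum_powerset_insert ha, ← sum_add_distrib, sum_mul]
  refine sum_congr rfl fun T hT => ?_
  have hT := mem_powerset.mp hT
  have haT : a ∉ T := fun h => ha (hT h)
  rw [cutProd_insert_left ha hT, cutProd_insert_insert ha hT, card_insert_of_notMem haT,
    ← prod_congr rfl fun j hj => hp j (mem_sdiff.mp hj).1, ← prod_congr rfl fun j hj => hq j (hT hj),
    prod_mul_distrib, prod_mul_distrib, ← prod_sdiff hT]
  ring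

theorem cutNumer_insert_of_eq_zero (ha : a ∉ A) {d p q : ι → ℂ} (hd : d a = 0) :
    cutNumer f c z (insert a A) d p q
      = ∑ T ∈ A.powerset, c (T.card + 1) * cutProd f z A T *
        (p a * ((∏ i ∈ T, (f (z i - z a) * d i)) * ∏ j ∈ A \ T, p j)
          + q a * ((∏ i ∈ T, q i) * ∏ j ∈ A \ T, (f (z a - z j) * d j))) := by
  unfold cutNumer
  rw [sum_powerset_insert ha, ← sum_add_distrib]
  refine sum_congr rfl fun T hT => ?_
  have hT := mem_powerset.mp hT
  have haT : a ∉ T := fun h => ha (hT h)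
  have haT' : a ∉ A \ T := fun h => ha (mem_sdiff.mp h).1
  rw [cutProd_insert_left ha hT, cutProd_insert_insert ha hT, card_insert_of_notMem haT,
    insert_sdiff_insert, sdiff_insert_of_notMem ha, insert_sdiff_of_notMem _ haT,
    prod_insert haT, prod_insert haT, prod_insert haT', prod_insert haT', hd,
    prod_mul_distrib, prod_mul_distrib]
  ring

theorem cutNumer_eq_zero (ha : a ∉ A) {d p q : ι → ℂ} (hd : d a = 0) (hpq : p a + q a = 0)
    (hp : ∀ j ∈ A, f (z a - z j) * d j = p j) (hq : ∀ j ∈ A, f (z j - z a) * d j = q j) :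
    cutNumer f c z (insert a A) d p q = 0 := by
  rw [cutNumer_insert_of_eq_zero ha hd]
  refine sum_eq_zero fun T hT => ?_
  rw [prod_congr rfl fun j hj => hp j (mem_sdiff.mp hj).1,
    prod_congr rfl fun j hj => hq j (mem_powerset.mp hT hj), ← add_mul, hpq, zero_mul, mul_zero]

theorem cutNumer_eq_left (ha : a ∉ A) {d p q : ι → ℂ} (hd : d a = 0) (hqa : q a = 0)
    (hp : ∀ j ∈ A, f (z j - z a) * d j = p j) :
    cutNumer f c z (insert a A) d p q
      = (p a * ∏ j ∈ A, p j) * cutSum f (fun n => c (n + 1)) z A := by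
  rw [cutNumer_insert_of_eq_zero ha hd, cutSum, mul_sum]
  refine sum_congr rfl fun T hT => ?_
  have hT := mem_powerset.mp hT
  rw [prod_congr rfl fun j hj => hp j (hT hj), hqa, ← prod_sdiff hT]
  ring

theorem cutNumer_eq_right (ha : a ∉ A) {d p q : ι → ℂ} (hd : d a = 0) (hpa : p a = 0)
    (hq : ∀ j ∈ A, f (z a - z j) * d j = q j) :
    cutNumer f c z (insert a A) d p q
      = (q a * ∏ j ∈ A, q j) * cutSum f (fun n => c (n + 1)) z A := by
  rw [cutNumer_insert_of_eq_zero ha hd, cutSum, mul_sum]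
  refine sum_congr rfl fun T hT => ?_
  have hT := mem_powerset.mp hT
  rw [prod_congr rfl fun j hj => hq j (mem_sdiff.mp hj).1, hpa, ← prod_sdiff hT]
  ring

end cut

/-- The kernel `[w - δ][w - κ + δ] / ([w][w - κ])`. -/
noncomputable def kern (br : ℂ → ℂ) (δ κ w : ℂ) : ℂ :=
  br (w - δ) * br (w - κ + δ) / (br w * br (w - κ))

/-- The common denominator of `kern br δ κ w` and `kern br δ κ (-w)`. -/
noncomputable def kernDen (br : ℂ → ℂ) (κ w : ℂ) : ℂ :=
  br w * br (w - κ) * br (w + κ)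

/-- The numerator of `kern br δ κ w` over `kernDen br κ w`. -/
noncomputable def kernNum (br : ℂ → ℂ) (δ κ w : ℂ) : ℂ :=
  br (w - δ) * br (w - κ + δ) * br (w + κ)

section kern

variable {br : ℂ → ℂ} {δ κ w : ℂ}

theorem kern_mul_kernDen (h : kernDen br κ w ≠ 0) :
    kern br δ κ w * kernDen br κ w = kernNum br δ κ w := by
  have h' : br w * br (w - κ) ≠ 0 := left_ne_zero_of_mul h
  rw [kern, kernDen, kernNum, ← mul_assoc, div_mul_cancel₀ _ h']

theorem kernDen_neg (hb : IsBracket br) (w : ℂ) : kernDen br κ (-w) = -kernDen br κ w := by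
  rw [kernDen, kernDen, show -w - κ = -(w + κ) by ring, show -w + κ = -(w - κ) by ring, hb.odd,
    hb.odd, hb.odd]
  ring

theorem kern_neg_mul_kernDen (hb : IsBracket br) (h : kernDen br κ w ≠ 0) :
    kern br δ κ (-w) * kernDen br κ w = -kernNum br δ κ (-w) := by
  rw [← kern_mul_kernDen, kernDen_neg hb]
  · ring
  · rw [kernDen_neg hb]
    exact neg_ne_zero.mpr h

theorem kern_sub (hb : IsBracket br) (w : ℂ) : kern br δ κ (κ - w) = kern br δ κ w := by
  rw [kern, kern, show κ - w - δ = -(w - κ + δ) by ring, show κ - w - κ + δ = -(w - δ) by ring,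
    show κ - w = -(w - κ) by ring, show -(w - κ) - κ = -w by ring, hb.odd, hb.odd, hb.odd, hb.odd]
  ring

theorem kern_self (hb : IsBracket br) : kern br δ κ δ = 0 := by
  rw [kern, sub_self, hb.zero, zero_mul, zero_div]

theorem kernDen_zero (hb : IsBracket br) : kernDen br κ 0 = 0 := by
  rw [kernDen, hb.zero, zero_mul, zero_mul]

theorem kernDen_self (hb : IsBracket br) : kernDen br κ κ = 0 := by
  rw [kernDen, sub_self, hb.zero, mul_zero, zero_mul]

theorem kernNum_neg_self (hb : IsBracket br) : kernNum br δ κ (-κ) = 0 := by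
  rw [kernNum, neg_add_cancel, hb.zero, mul_zero]

theorem kernDen_eq_thetaProd (br : ℂ → ℂ) (κ a u : ℂ) :
    kernDen br κ (u - a) = thetaProd br {a, a + κ, a - κ} u := by
  simp [thetaProd, kernDen, mul_assoc, sub_sub, sub_add]

theorem kernNum_eq_thetaProd (br : ℂ → ℂ) (δ κ a u : ℂ) :
    kernNum br δ κ (u - a) = thetaProd br {a + δ, a + κ - δ, a - κ} u := by
  simp only [thetaProd, kernNum, Multiset.insert_eq_cons, Multiset.map_cons, Multiset.prod_cons,
    Multiset.map_singleton, Multiset.prod_singleton]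
  rw [← mul_assoc]
  congr 3 <;> ring

theorem neg_kernNum_neg_eq_thetaProd (hb : IsBracket br) (δ κ a u : ℂ) :
    -kernNum br δ κ (-(u - a)) = thetaProd br {a - δ, a - κ + δ, a + κ} u := by
  simp only [thetaProd, kernNum, Multiset.insert_eq_cons, Multiset.map_cons, Multiset.prod_cons,
    Multiset.map_singleton, Multiset.prod_singleton]
  rw [show -(u - a) - δ = -(u - (a - δ)) by ring,
    show -(u - a) - κ + δ = -(u - (a - κ + δ)) by ring,
    show -(u - a) + κ = -(u - (a + κ)) by ring, hb.odd, hb.odd, hb.odd]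
  ring

end kern

theorem prod_mul_prod_mem_thetaSpace {br : ℂ → ℂ} {ι : Type*} [DecidableEq ι] {A T : Finset ι}
    (hT : T ⊆ A) (z : ι → ℂ) (s s' : ι → Multiset ℂ)
    (hs : ∀ i, (s i).card = 3 ∧ (s i).sum = 3 * z i)
    (hs' : ∀ i, (s' i).card = 3 ∧ (s' i).sum = 3 * z i) :
    (fun u => (∏ i ∈ T, thetaProd br (s i) u) * ∏ j ∈ A \ T, thetaProd br (s' j) u)
      ∈ thetaSpace br (A.card * 3) (∑ i ∈ A, 3 * z i) := by
  convert thetaProd_mem br (∑ i ∈ T, s i + ∑ i ∈ A \ T, s' i) using 2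
  · rw [Multiset.card_add, Multiset.card_sum, Multiset.card_sum, sum_congr rfl fun i _ => (hs i).1,
      sum_congr rfl fun i _ => (hs' i).1, sum_const, sum_const, ← card_sdiff_add_card_eq_card hT]
    simp only [smul_eq_mul]
    ring
  · rw [Multiset.sum_add, ← sum_sdiff hT, add_comm]
    congr 1
    · rw [← Multiset.coe_sumAddMonoidHom, map_sum]
      exact sum_congr rfl fun i _ => (hs i).2.symm
    · rw [← Multiset.coe_sumAddMonoidHom, map_sum]
      exact sum_congr rfl fun i _ => (hs' i).2.symm
  · rw [thetaProd_add, thetaProd_sum, thetaProd_sum]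

theorem cutNumer_mem_thetaSpace {br : ℂ → ℂ} {ι : Type*} [DecidableEq ι] {A : Finset ι}
    (f : ℂ → ℂ) (c : ℕ → ℂ) (z z' : ι → ℂ) (s s' s'' : ι → Multiset ℂ)
    (hs : ∀ i, (s i).card = 3 ∧ (s i).sum = 3 * z i)
    (hs' : ∀ i, (s' i).card = 3 ∧ (s' i).sum = 3 * z i)
    (hs'' : ∀ i, (s'' i).card = 3 ∧ (s'' i).sum = 3 * z i) :
    (fun u => cutNumer f c z' A (fun i => thetaProd br (s i) u) (fun i => thetaProd br (s' i) u)
        fun i => thetaProd br (s'' i) u)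
      ∈ thetaSpace br (A.card * 3) (∑ i ∈ A, 3 * z i) := by
  unfold cutNumer
  have key : ∀ T ∈ A.powerset, cutProd f z' A T •
      (c (T.card + 1) • (fun u => (∏ i ∈ T, thetaProd br (s i) u) * ∏ j ∈ A \ T, thetaProd br (s' j) u)
      + c T.card • fun u => (∏ i ∈ T, thetaProd br (s'' i) u) * ∏ j ∈ A \ T, thetaProd br (s j) u)
      ∈ thetaSpace br (A.card * 3) (∑ i ∈ A, 3 * z i) := fun T hT =>
    Submodule.smul_mem _ _ (Submodule.add_mem _
      (Submodule.smul_mem _ _ (prod_mul_prod_mem_thetaSpace (mem_powerset.mp hT) z _ _ hs hs'))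
      (Submodule.smul_mem _ _ (prod_mul_prod_mem_thetaSpace (mem_powerset.mp hT) z _ _ hs'' hs)))
  convert Submodule.sum_mem _ key using 1
  funext u
  simp [Finset.sum_apply, mul_add]

section exchange

variable {br : ℂ → ℂ} {δ κ : ℂ} {ι : Type*} [DecidableEq ι]

/-- As a function of one variable, the difference of the two cut sums is constant. -/
theorem exists_cutSum_sub_eq_const (hb : IsBracket br) (hκ : ∀ e : ℤ, e ≠ 0 → br (e * κ) ≠ 0)
    {A : Finset ι} {a : ι} (ha : a ∉ A) (z : ι → ℂ)
    (hz : ∀ i ∈ A, ∀ j ∈ A, i ≠ j → ∀ e : ℤ, br (z i - z j + e * κ) ≠ 0)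
    (ih : ∀ b ∈ A, ∀ c : ℕ → ℂ, cutSum (kern br δ κ) c z (A.erase b)
      = cutSum (kern br δ κ) c (-z) (A.erase b)) (c : ℕ → ℂ) :
    ∃ C : ℂ, ∀ z' : ι → ℂ, (∀ i ∈ A, z' i = z i) →
      (∀ j ∈ A, kernDen br κ (z' a - z j) ≠ 0) →
      cutSum (kern br δ κ) c z' (insert a A) - cutSum (kern br δ κ) c (-z') (insert a A) = C := by
  set d : ℂ → ι → ℂ := fun u i => kernDen br κ (u - z i) with hd
  set p : ℂ → ι → ℂ := fun u i => kernNum br δ κ (u - z i) with hp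
  set q : ℂ → ι → ℂ := fun u i => -kernNum br δ κ (-(u - z i)) with hq
  have hmem : (fun u => cutNumer (kern br δ κ) c z A (d u) (p u) (q u)
      - cutNumer (kern br δ κ) c (-z) A (d u) (q u) (p u))
      ∈ thetaSpace br (A ×ˢ ({-1, 0, 1} : Finset ℤ)).card
        (∑ x ∈ A ×ˢ ({-1, 0, 1} : Finset ℤ), (z x.1 + x.2 * κ)) := by
    have e₁ : (A ×ˢ ({-1, 0, 1} : Finset ℤ)).card = A.card * 3 := by
      rw [card_product]
      rfl
    have e₂ : ∑ x ∈ A ×ˢ ({-1, 0, 1} : Finset ℤ), (z x.1 + x.2 * κ) = ∑ i ∈ A, 3 * z i := by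
      rw [sum_product]
      refine sum_congr rfl fun i _ => ?_
      simp
      ring
    rw [e₁, e₂]
    simp only [hd, hp, hq, kernDen_eq_thetaProd, kernNum_eq_thetaProd,
      neg_kernNum_neg_eq_thetaProd hb]
    refine Submodule.sub_mem _ ?_ ?_ <;>
    refine cutNumer_mem_thetaSpace _ _ _ _ _ _ _ (fun i => ⟨by simp, ?_⟩) (fun i => ⟨by simp, ?_⟩)
      (fun i => ⟨by simp, ?_⟩) <;>
    · simp only [Multiset.insert_eq_cons, Multiset.sum_cons, Multiset.sum_singleton]
      ring
  have hden : ∀ b ∈ A, ∀ j ∈ A.erase b, ∀ e : ℤ, kernDen br κ (z b + e * κ - z j) ≠ 0 := by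
    intro b hb' j hj e
    obtain ⟨hjb, hj⟩ := mem_erase.mp hj
    have := hz b hb' j hj (Ne.symm hjb)
    refine mul_ne_zero (mul_ne_zero ?_ ?_) ?_
    · convert this e using 2
      ring
    · convert this (e - 1) using 2
      push_cast
      ring
    · convert this (e + 1) using 2
      push_cast
      ring
  have hzero : ∀ x ∈ A ×ˢ ({-1, 0, 1} : Finset ℤ),
      (fun u => cutNumer (kern br δ κ) c z A (d u) (p u) (q u)
        - cutNumer (kern br δ κ) c (-z) A (d u) (q u) (p u)) (z x.1 + x.2 * κ) = 0 := by
    rintro ⟨b, e⟩ hx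
    obtain ⟨hbA, he⟩ := mem_product.mp hx
    have hAb : insert b (A.erase b) = A := insert_erase hbA
    have hbe : b ∉ A.erase b := notMem_erase b A
    simp only [mem_insert, mem_singleton] at he
    have hD := fun j hj => hden b hbA j hj e
    have hP : ∀ j ∈ A.erase b,
        kern br δ κ (z b + e * κ - z j) * d (z b + e * κ) j = p (z b + e * κ) j :=
      fun j hj => kern_mul_kernDen (hD j hj)
    have hQ : ∀ j ∈ A.erase b,
        kern br δ κ (-(z b + e * κ - z j)) * d (z b + e * κ) j = q (z b + e * κ) j :=
      fun j hj => kern_neg_mul_kernDen hb (hD j hj)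
    have ihb := ih b hbA fun n => c (n + 1)
    simp only
    set u := z b + e * κ with hu
    rw [← hAb]
    rcases he with rfl | rfl | rfl
    · have hub : u - z b = -κ := by rw [hu]; push_cast; ring
      have h1 : d u b = 0 := by
        simp only [hd]
        rw [hub, kernDen_neg hb, kernDen_self hb, neg_zero]
      have h2 : p u b = 0 := by
        simp only [hp]
        rw [hub, kernNum_neg_self hb]
      have hk : ∀ j, kern br δ κ (z b - z j) = kern br δ κ (-(u - z j)) := fun j => by
        rw [← kern_sub hb]
        congr 1
        rw [hu]; push_cast; ring
      rw [cutNumer_eq_right hbe h1 h2 fun j hj => by rw [hk, hQ j hj],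
        cutNumer_eq_left hbe h1 h2 fun j hj => by
          rw [Pi.neg_apply, Pi.neg_apply, neg_sub_neg, hk, hQ j hj], ihb, sub_self]
    · have hub : u - z b = 0 := by rw [hu]; push_cast; ring
      have huz : u = z b := sub_eq_zero.mp hub
      have h1 : d u b = 0 := by
        simp only [hd]
        rw [hub, kernDen_zero hb]
      have h2 : p u b + q u b = 0 := by
        simp only [hp, hq]
        rw [hub, neg_zero, add_neg_cancel]
      have hP' : ∀ j ∈ A.erase b, kern br δ κ (z b - z j) * d u j = p u j := fun j hj => by
        rw [← huz]; exact hP j hj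
      have hQ' : ∀ j ∈ A.erase b, kern br δ κ (z j - z b) * d u j = q u j := fun j hj => by
        rw [← huz, ← neg_sub]; exact hQ j hj
      rw [cutNumer_eq_zero hbe h1 h2 hP' hQ', cutNumer_eq_zero hbe h1 (by rw [add_comm, h2])
        (fun j hj => by rw [Pi.neg_apply, Pi.neg_apply, neg_sub_neg, hQ' j hj])
        (fun j hj => by rw [Pi.neg_apply, Pi.neg_apply, neg_sub_neg, hP' j hj]), sub_self]
    · have hub : u - z b = κ := by rw [hu]; push_cast; ring
      have h1 : d u b = 0 := by
        simp only [hd]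
        rw [hub, kernDen_self hb]
      have h2 : q u b = 0 := by
        simp only [hq]
        rw [hub, kernNum_neg_self hb, neg_zero]
      have hk : ∀ j, kern br δ κ (z j - z b) = kern br δ κ (u - z j) := fun j => by
        rw [← kern_sub hb]
        congr 1
        rw [hu]; push_cast; ring
      rw [cutNumer_eq_left hbe h1 h2 fun j hj => by rw [hk, hP j hj],
        cutNumer_eq_right hbe h1 h2 fun j hj => by
          rw [Pi.neg_apply, Pi.neg_apply, neg_sub_neg, hk, hP j hj], ihb, sub_self]
  obtain ⟨C, hC⟩ := exists_eq_const_mul_prod hb (A ×ˢ ({-1, 0, 1} : Finset ℤ))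
    (fun x => z x.1 + x.2 * κ) (by
      rintro ⟨i, e⟩ hi ⟨j, e'⟩ hj hne
      have hi := (mem_product.mp hi).1
      have hj := (mem_product.mp hj).1
      have he : z i + e * κ - (z j + e' * κ) = z i - z j + ((e - e' : ℤ) : ℂ) * κ := by
        push_cast; ring
      simp only
      rw [he]
      by_cases hij : i = j
      · subst hij
        rw [sub_self, zero_add]
        refine hκ _ (sub_ne_zero.mpr fun h => hne (by rw [h]))
      · exact hz i hi j hj hij _) hmem hzero
  refine ⟨C, fun z' hz' hD => ?_⟩
  have hprod : ∏ x ∈ A ×ˢ ({-1, 0, 1} : Finset ℤ), br (z' a - (z x.1 + x.2 * κ))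
      = ∏ j ∈ A, kernDen br κ (z' a - z j) := by
    rw [prod_product]
    refine prod_congr rfl fun j _ => ?_
    rw [kernDen_eq_thetaProd]
    simp [thetaProd]
    ring_nf
  have hC' := hC (z' a)
  rw [hprod] at hC'
  refine mul_right_cancel₀ (prod_ne_zero_iff.mpr hD) (Eq.trans ?_ hC')
  have hPz : ∀ j ∈ A, kern br δ κ (z' a - z' j) * d (z' a) j = p (z' a) j := fun j hj => by
    rw [hz' j hj]
    exact kern_mul_kernDen (hD j hj)
  have hQz : ∀ j ∈ A, kern br δ κ (z' j - z' a) * d (z' a) j = q (z' a) j := fun j hj => by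
    rw [hz' j hj, ← neg_sub]
    exact kern_neg_mul_kernDen hb (hD j hj)
  have hcongr : ∀ w w' : ι → ℂ, (∀ i ∈ A, w i = w' i) → ∀ d p q : ι → ℂ,
      cutNumer (kern br δ κ) c w A d p q = cutNumer (kern br δ κ) c w' A d p q :=
    fun w w' h d p q => sum_congr rfl fun T hT => by rw [cutProd_congr (mem_powerset.mp hT) h]
  rw [sub_mul]
  refine congrArg₂ _ ?_ ?_
  · rw [← hcongr z' z hz', ← cutSum_insert_mul ha hPz hQz]
  · rw [← hcongr (-z') (-z) (fun i hi => by simp [hz' i hi]), ← cutSum_insert_mul ha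
      (fun j hj => by rw [Pi.neg_apply, Pi.neg_apply, neg_sub_neg, hQz j hj])
      (fun j hj => by rw [Pi.neg_apply, Pi.neg_apply, neg_sub_neg, hPz j hj])]

theorem cutSum_neg_eq [Fintype ι] (hb : IsBracket br) (hκ : ∀ e : ℤ, e ≠ 0 → br (e * κ) ≠ 0)
    (A : Finset ι) (c : ℕ → ℂ) (z : ι → ℂ)
    (hz : ∀ i j, i ≠ j → ∀ e : ℤ, br (z i - z j + e * κ) ≠ 0) :
    cutSum (kern br δ κ) c z A = cutSum (kern br δ κ) c (-z) A := by
  induction hn : A.card using Nat.strong_induction_on generalizing A c z with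
  | _ n ih =>
  subst hn
  have hstep : ∀ (a : ι) (z z' : ι → ℂ), (∀ i j, i ≠ j → ∀ e : ℤ, br (z i - z j + e * κ) ≠ 0) →
      (∀ i j, i ≠ j → ∀ e : ℤ, br (z' i - z' j + e * κ) ≠ 0) → (∀ i, i ≠ a → z' i = z i) →
      cutSum (kern br δ κ) c z' A - cutSum (kern br δ κ) c (-z') A
        = cutSum (kern br δ κ) c z A - cutSum (kern br δ κ) c (-z) A := by
    intro a z z' hz hz' h
    by_cases ha : a ∈ A
    · rw [← insert_erase ha]
      obtain ⟨C, hC⟩ := exists_cutSum_sub_eq_const (δ := δ) hb hκ (notMem_erase a A) z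
        (fun i _ j _ => hz i j)
        (fun b hb' c => ih _ ((card_erase_le).trans_lt (card_erase_lt_of_mem ha)) _ c z hz rfl) c
      have hD : ∀ w : ι → ℂ, (∀ i j, i ≠ j → ∀ e : ℤ, br (w i - w j + e * κ) ≠ 0) →
          ∀ j, j ≠ a → kernDen br κ (w a - w j) ≠ 0 := by
        intro w hw j hj
        have := hw a j hj.symm
        refine mul_ne_zero (mul_ne_zero ?_ ?_) ?_
        · simpa using this 0
        · simpa [sub_eq_add_neg] using this (-1)
        · simpa using this 1
      rw [hC z' (fun i hi => h i (ne_of_mem_erase hi)) fun j hj => by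
          rw [← h j (ne_of_mem_erase hj)]
          exact hD z' hz' j (ne_of_mem_erase hj),
        hC z (fun _ _ => rfl) fun j hj => hD z hz j (ne_of_mem_erase hj)]
    · have e : ∀ i ∈ A, z' i = z i := fun i hi => h i (by rintro rfl; exact ha hi)
      rw [cutSum_congr e, cutSum_congr (z := -z') (z' := -z) fun i hi => by simp [e i hi]]
  set θ : ι → ℂ := fun i => ((Fintype.equivFin ι i : ℕ) : ℂ) + 1 with hθ
  have hθ0 : ∀ i, θ i ≠ 0 := fun i => by
    simp only [hθ]
    exact Nat.cast_add_one_ne_zero _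
  have hθi : ∀ i j, i ≠ j → θ i - θ j ≠ 0 := fun i j hij h => hij <| by
    simpa [hθ, sub_eq_zero, Fin.val_inj] using h
  have hgen : ∀ z : ι → ℂ, ∀ᶠ t in residual ℂ, ∀ i j, i ≠ j → ∀ e : ℤ,
      br (z i - t * θ j + e * κ) ≠ 0 ∧ br (t * θ i - z j + e * κ) ≠ 0
        ∧ br (t * θ i - t * θ j + e * κ) ≠ 0 := by
    intro z
    rw [Filter.eventually_all]
    intro i
    rw [Filter.eventually_all]
    intro j
    rw [Filter.eventually_imp_distrib_left]
    intro hij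
    rw [eventually_countable_forall]
    intro e
    filter_upwards [hb.eventually_ne (z i + e * κ) (neg_ne_zero.mpr (hθ0 j)),
      hb.eventually_ne (-z j + e * κ) (hθ0 i), hb.eventually_ne (e * κ) (hθi i j hij)]
      with t h₁ h₂ h₃
    refine ⟨?_, ?_, ?_⟩
    · convert h₁ using 2; ring
    · convert h₂ using 2; ring
    · convert h₃ using 2; ring
  obtain ⟨t, ht, ht'⟩ := exists_of_residual ((hgen z).and (hgen (-z)))
  set w : ι → ℂ := fun i => t * θ i with hw
  have hmix : ∀ z : ι → ℂ, (∀ i j, i ≠ j → ∀ e : ℤ, br (z i - z j + e * κ) ≠ 0) →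
      (∀ i j, i ≠ j → ∀ e : ℤ, br (z i - t * θ j + e * κ) ≠ 0 ∧ br (t * θ i - z j + e * κ) ≠ 0
        ∧ br (t * θ i - t * θ j + e * κ) ≠ 0) →
      cutSum (kern br δ κ) c w A - cutSum (kern br δ κ) c (-w) A
        = cutSum (kern br δ κ) c z A - cutSum (kern br δ κ) c (-z) A := by
    intro z hz ht
    have hgenQ : ∀ Q : Finset ι, ∀ i j, i ≠ j → ∀ e : ℤ,
        br (Q.piecewise w z i - Q.piecewise w z j + e * κ) ≠ 0 := by
      intro Q i j hij e
      obtain ⟨h₁, h₂, h₃⟩ := ht i j hij e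
      by_cases hi : i ∈ Q <;> by_cases hj : j ∈ Q <;> simp only [Finset.piecewise, hi, hj, if_true,
        if_false]
      · exact h₃
      · exact h₂
      · exact h₁
      · exact hz i j hij e
    have hQ : ∀ Q : Finset ι, cutSum (kern br δ κ) c (Q.piecewise w z) A
        - cutSum (kern br δ κ) c (-Q.piecewise w z) A
        = cutSum (kern br δ κ) c z A - cutSum (kern br δ κ) c (-z) A := by
      intro Q
      induction Q using Finset.induction_on with
      | empty => simp
      | insert a Q ha ihQ =>
        rw [← ihQ]
        exact hstep a _ _ (hgenQ Q) (hgenQ _) fun i hi => by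
          simp [Finset.piecewise, hi]
    simpa using hQ univ
  have h₁ := hmix z hz ht
  have h₂ := hmix (-z) (fun i j hij e => by
    convert hz j i hij.symm e using 2
    simp only [Pi.neg_apply]
    ring) ht'
  rw [neg_neg] at h₂
  have := h₁.symm.trans h₂
  linear_combination this / 2

end exchange

theorem cutSum_neg_univ {ι : Type*} [Fintype ι] [DecidableEq ι] (f : ℂ → ℂ) (c : ℕ → ℂ)
    (z : ι → ℂ) :
    cutSum f c (-z) univ = cutSum f (fun n => c (Fintype.card ι - n)) z univ := by
  unfold cutSum
  rw [powerset_univ, ← Equiv.sum_comp (Function.Involutive.toPerm compl compl_involutive)]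
  refine sum_congr rfl fun T _ => ?_
  rw [Function.Involutive.coe_toPerm, card_compl]
  congr 1
  unfold cutProd
  rw [prod_comm]
  refine prod_congr (by ext; simp) fun i _ => prod_congr (by ext; simp) fun j _ => ?_
  rw [Pi.neg_apply, Pi.neg_apply, neg_sub_neg]

/-- The product of the kernel over the pairs formed by the first `p` points of one arithmetic
progression with step `δ` and the points with index in `[q, L)` of another one. -/
noncomputable def strProd (br : ℂ → ℂ) (δ κ X : ℂ) (p q L : ℕ) : ℂ :=
  ∏ a ∈ range p, ∏ b ∈ Ico q L, kern br δ κ (X + ((a : ℂ) - b) * δ)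

section strings

variable {ι : Type*} [Fintype ι]

/-- The union of initial segments of lengths `M c` in a disjoint union of chains. -/
def initSeg (L M : ι → ℕ) : Finset (Σ c, Fin (L c)) :=
  univ.filter fun s => (s.2 : ℕ) < M s.1

theorem prod_initSeg {R : Type*} [CommMonoid R] {L M : ι → ℕ} (hM : ∀ c, M c ≤ L c)
    (h : ι → ℕ → R) :
    ∏ s ∈ initSeg L M, h s.1 s.2 = ∏ c, ∏ a ∈ range (M c), h c a := by
  rw [initSeg, prod_filter, Fintype.prod_sigma]
  refine prod_congr rfl fun c _ => ?_
  rw [Fin.prod_univ_eq_prod_range (fun a => if a < M c then h c a else 1) (L c), ← prod_filter]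
  refine prod_congr ?_ fun _ _ => rfl
  ext a
  have := hM c
  simp
  omega

theorem card_initSeg {L M : ι → ℕ} (hM : ∀ c, M c ≤ L c) : (initSeg L M).card = ∑ c, M c := by
  have := congrArg Multiplicative.toAdd (prod_initSeg hM fun _ _ => Multiplicative.ofAdd (1 : ℕ))
  simpa [toAdd_prod] using this

variable [DecidableEq ι]

theorem prod_initSeg_compl {R : Type*} [CommMonoid R] (L M : ι → ℕ) (h : ι → ℕ → R) :
    ∏ s ∈ univ \ initSeg L M, h s.1 s.2 = ∏ c, ∏ a ∈ Ico (M c) (L c), h c a := by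
  rw [← compl_eq_univ_sdiff, initSeg, compl_filter, prod_filter, Fintype.prod_sigma]
  refine prod_congr rfl fun c _ => ?_
  rw [Fin.prod_univ_eq_prod_range (fun a => if ¬a < M c then h c a else 1) (L c), ← prod_filter]
  refine prod_congr ?_ fun _ _ => rfl
  ext a
  simp
  omega

theorem initSeg_injOn (L : ι → ℕ) :
    Set.InjOn (initSeg L) (Fintype.piFinset fun c => range (L c + 1) : Finset (ι → ℕ)) := by
  have key : ∀ M M' : ι → ℕ, (∀ c, M' c ≤ L c) → initSeg L M = initSeg L M' → ∀ c, M' c ≤ M c := by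
    intro M M' hM' h c
    by_contra! hc
    have : (⟨c, ⟨M c, hc.trans_le (hM' c)⟩⟩ : Σ c, Fin (L c)) ∈ initSeg L M' := by
      simp [initSeg, hc]
    rw [← h] at this
    simp [initSeg] at this
  intro M hM M' hM' h
  rw [mem_coe, Fintype.mem_piFinset] at hM hM'
  simp only [mem_range, Order.lt_add_one_iff] at hM hM'
  funext c
  exact le_antisymm (key M' M hM h.symm c) (key M M' hM' h c)

theorem exists_eq_initSeg {L : ι → ℕ} (T : Finset (Σ c, Fin (L c)))
    (hT : ∀ c a (ha : a + 1 < L c), (⟨c, ⟨a + 1, ha⟩⟩ : Σ c, Fin (L c)) ∈ T →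
      (⟨c, ⟨a, by omega⟩⟩ : Σ c, Fin (L c)) ∈ T) :
    ∃ M : ι → ℕ, (∀ c, M c ≤ L c) ∧ initSeg L M = T := by
  classical
  have hex : ∀ c, ∃ a, ∀ h : a < L c, (⟨c, ⟨a, h⟩⟩ : Σ c, Fin (L c)) ∉ T :=
    fun c => ⟨L c, fun h => absurd h (lt_irrefl _)⟩
  refine ⟨fun c => Nat.find (hex c), fun c => Nat.find_min' _ fun h => absurd h (lt_irrefl _), ?_⟩
  ext ⟨c, a, ha⟩
  simp only [initSeg, mem_filter, mem_univ, true_and]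
  constructor
  · intro h
    have := Nat.find_min (hex c) h
    push Not at this
    exact this.2
  · intro h
    by_contra! hle
    have : ∀ a, Nat.find (hex c) ≤ a → ∀ ha : a < L c, (⟨c, ⟨a, ha⟩⟩ : Σ c, Fin (L c)) ∉ T := by
      intro a hle
      induction a, hle using Nat.le_induction with
      | base => exact Nat.find_spec (hex c)
      | succ a _ ih => exact fun ha h => ih (by omega) (hT c a ha h)
    exact this a hle ha h

variable {br : ℂ → ℂ} {δ κ : ℂ}

theorem cutSum_strings (hb : IsBracket br) (w : ι → ℂ) (L : ι → ℕ) (c : ℕ → ℂ) :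
    cutSum (kern br δ κ) c (fun s : Σ c, Fin (L c) => w s.1 + (s.2 : ℕ) * δ) univ
      = ∑ M ∈ Fintype.piFinset fun c => range (L c + 1),
        c (∑ i, M i) * ∏ i, ∏ j, strProd br δ κ (w i - w j) (M i) (M j) (L j) := by
  symm
  refine sum_of_injOn (initSeg L) (initSeg_injOn L) (fun _ _ => by simp) ?_ ?_
  · intro T _ hT
    have : ¬ ∀ c a (ha : a + 1 < L c), (⟨c, ⟨a + 1, ha⟩⟩ : Σ c, Fin (L c)) ∈ T →
      (⟨c, ⟨a, by omega⟩⟩ : Σ c, Fin (L c)) ∈ T := by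
      intro h
      obtain ⟨M, hM, rfl⟩ := exists_eq_initSeg T h
      exact hT ⟨M, by simpa [Nat.lt_succ_iff] using hM, rfl⟩
    push Not at this
    obtain ⟨i, a, ha, h₁, h₂⟩ := this
    refine mul_eq_zero_of_right _ (prod_eq_zero h₁ (prod_eq_zero (i := ⟨i, ⟨a, by omega⟩⟩)
      (by simpa using h₂) ?_))
    rw [← kern_self (δ := δ) (κ := κ) hb]
    congr 1
    push_cast
    ring
  · intro M hM
    have hM : ∀ i, M i ≤ L i := by simpa [Nat.lt_succ_iff] using hM
    rw [card_initSeg hM]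
    congr 1
    unfold cutProd
    rw [prod_congr rfl fun (s : Σ c, Fin (L c)) _ => prod_initSeg_compl L M
        fun j b => kern br δ κ (w s.1 + (s.2 : ℕ) * δ - (w j + b * δ)),
      prod_initSeg hM fun i a => ∏ j, ∏ b ∈ Ico (M j) (L j),
        kern br δ κ (w i + a * δ - (w j + b * δ))]
    refine prod_congr rfl fun i _ => ?_
    rw [prod_comm]
    refine prod_congr rfl fun j _ => prod_congr rfl fun a _ => prod_congr rfl fun b _ => ?_
    congr 1
    ring

/-- The exchange symmetry of the kernel sum under `M ↦ L - M` of the total degree. -/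
theorem strings_exchange (hb : IsBracket br) (hκ : ∀ e : ℤ, e ≠ 0 → br (e * κ) ≠ 0) (w : ι → ℂ)
    (hw : ∀ i j, ∀ n e : ℤ, (i = j → n = 0 → e ≠ 0) → br (w i - w j + n * δ + e * κ) ≠ 0)
    (L : ι → ℕ) (c : ℕ → ℂ) :
    ∑ M ∈ Fintype.piFinset fun c => range (L c + 1),
        c (∑ i, M i) * ∏ i, ∏ j, strProd br δ κ (w i - w j) (M i) (M j) (L j)
      = ∑ M ∈ Fintype.piFinset fun c => range (L c + 1),
        c (∑ i, L i - ∑ i, M i) * ∏ i, ∏ j, strProd br δ κ (w i - w j) (M i) (M j) (L j) := by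
  rw [← cutSum_strings hb w L c, ← cutSum_strings hb w L fun n => c (∑ i, L i - n),
    cutSum_neg_eq hb hκ, cutSum_neg_univ]
  · simp
  · rintro ⟨i, a⟩ ⟨j, b⟩ hne e
    convert hw i j ((a : ℕ) - (b : ℕ) : ℤ) e ?_ using 2
    · push_cast
      ring
    · rintro rfl hab
      exact absurd (by rw [Fin.ext (by omega : (a : ℕ) = b)]) hne

end strings

theorem sfac_natCast (br : ℂ → ℂ) (a x : ℂ) (n : ℕ) :
    sfac br a x (n : ℤ) = ∏ i ∈ range n, br (x + (i : ℂ) * a) := by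
  simp [sfac]

section telescope

variable {br : ℂ → ℂ} {δ κ : ℂ}

theorem kern_neg (hb : IsBracket br) (w : ℂ) :
    kern br δ κ (-w) = br (w + δ) * br (w + κ - δ) / (br w * br (w + κ)) := by
  unfold kern
  rw [show -w - δ = -(w + δ) by ring, show -w - κ + δ = -(w + κ - δ) by ring,
    show -w - κ = -(w + κ) by ring]
  simp only [hb.odd, neg_mul_neg]

theorem prod_range_kern (hb : IsBracket br) (X : ℂ) (q : ℕ)
    (h₁ : ∀ e : ℤ, -(q : ℤ) < e → br (X + e * δ) ≠ 0) (h₂ : ∀ e : ℤ, br (X + κ + e * δ) ≠ 0) :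
    ∏ a ∈ range q, kern br δ κ (-X + a * δ)
      = br (X + δ) * br (X + κ - q * δ) / (br (X + δ - q * δ) * br (X + κ)) := by
  have h₁' := h₁ 1 (by omega)
  have h₂' := h₂ 0
  simp only [Int.cast_one, one_mul, Int.cast_zero, zero_mul, add_zero] at h₁' h₂'
  induction q with
  | zero =>
    simp only [range_zero, prod_empty, Nat.cast_zero, zero_mul, sub_zero]
    simp only [mul_comm _ δ] at *
    field_simp
  | succ q ih =>
    have h₃ := h₁ (1 - q) (by push_cast; omega)
    have h₄ := h₁ (-q) (by push_cast; omega)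
    have h₅ := h₂ (-q)
    rw [prod_range_succ, ih fun e he => h₁ e (by push_cast; omega),
      show -X + (q : ℂ) * δ = -(X - q * δ) by ring, kern_neg hb]
    push_cast at h₃ h₄ h₅ ⊢
    rw [show X + (1 - (q : ℂ)) * δ = X + δ - q * δ by ring] at h₃
    rw [show X + -(q : ℂ) * δ = X - q * δ by ring] at h₄
    rw [show X + κ + -(q : ℂ) * δ = X + κ - q * δ by ring] at h₅
    rw [show X - (q : ℂ) * δ + δ = X + δ - q * δ by ring,
      show X - (q : ℂ) * δ + κ - δ = X + κ - (q + 1) * δ by ring,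
      show X - (q : ℂ) * δ + κ = X + κ - q * δ by ring,
      show X + δ - ((q : ℂ) + 1) * δ = X - q * δ by ring]
    simp only [mul_comm _ δ] at *
    field_simp

theorem prod_Ico_kern (hb : IsBracket br) (X : ℂ) (p s : ℕ)
    (h₁ : ∀ e : ℤ, br (X + e * δ) ≠ 0) (h₂ : ∀ e : ℤ, br (X + κ + e * δ) ≠ 0) :
    ∏ b ∈ Ico p (p + s), kern br δ κ (-X - b * δ)
      = br (X + (p + s : ℕ) * δ) * br (X + κ + (p - 1) * δ)
        / (br (X + p * δ) * br (X + κ + ((p + s : ℕ) - 1) * δ)) := by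
  induction s with
  | zero =>
    have h₃ := h₁ p
    have h₄ := h₂ (p - 1)
    push_cast at h₃ h₄
    simp only [add_zero, Ico_self, prod_empty]
    simp only [mul_comm _ δ] at *
    field_simp
  | succ s ih =>
    have h₃ := h₁ p
    have h₄ := h₁ (p + s)
    have h₅ := h₂ (p + s - 1)
    have h₆ := h₂ (p + s)
    rw [← add_assoc, prod_Ico_succ_top (by omega), ih,
      show -X - ((p + s : ℕ) : ℂ) * δ = -(X + (p + s : ℕ) * δ) by ring, kern_neg hb]
    push_cast at h₃ h₄ h₅ h₆ ⊢
    rw [show X + ((p : ℂ) + s) * δ + δ = X + (p + s + 1) * δ by ring,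
      show X + ((p : ℂ) + s) * δ + κ - δ = X + κ + (p + s - 1) * δ by ring,
      show X + ((p : ℂ) + s) * δ + κ = X + κ + (p + s) * δ by ring, add_sub_cancel_right]
    simp only [mul_comm _ δ] at *
    field_simp

theorem strProd_eq_sfac (hb : IsBracket br) (X : ℂ) (p q s : ℕ)
    (h₁ : ∀ e : ℤ, (p : ℤ) - q < e → br (X + e * δ) ≠ 0) (h₂ : ∀ e : ℤ, br (X + κ + e * δ) ≠ 0)
    (h₃ : ∀ e : ℤ, 0 < e → br (X + e * δ) ≠ 0) :
    sfac br δ (X + κ) p / sfac br δ (X + δ) p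
        * (sfac br δ (X + ((p : ℂ) - q) * δ + κ) s / sfac br δ (X + ((p : ℂ) - q) * δ + δ) s)
      = sfac br δ (X + κ) (p + s : ℕ) / sfac br δ (X + δ) (p + s : ℕ)
        * strProd br δ κ (-X) q p (p + s) := by
  simp only [sfac_natCast, strProd]
  rw [prod_comm]
  induction s with
  | zero => simp
  | succ s ih =>
    have h₄ := h₁ (p + s - q + 1) (by omega)
    have h₅ := h₂ (p + s)
    have h₆ := h₃ (p + s + 1) (by omega)
    rw [prod_range_succ, prod_range_succ, mul_div_mul_comm, ← mul_assoc, ih, ← add_assoc,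
      prod_range_succ, prod_range_succ, mul_div_mul_comm, prod_Ico_succ_top (by omega)]
    have := prod_range_kern (δ := δ) (κ := κ) hb (X + (p + s : ℕ) * δ) q
      (fun e he => by
        convert h₁ (p + s + e) (by omega) using 2
        push_cast
        ring)
      (fun e => by
        convert h₂ (p + s + e) using 2
        push_cast
        ring)
    rw [prod_congr rfl fun (a : ℕ) _ => show kern br δ κ (-X + ((a : ℂ) - (p + s : ℕ)) * δ)
      = kern br δ κ (-(X + (p + s : ℕ) * δ) + a * δ) by congr 1; ring, this]
    push_cast at h₄ h₅ h₆ ⊢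
    rw [show X + ((p : ℂ) - q) * δ + κ + s * δ = X + κ + (p + s - q) * δ by ring,
      show X + ((p : ℂ) - q) * δ + δ + s * δ = X + (p + s - q + 1) * δ by ring,
      show X + κ + ((p : ℂ) + s) * δ = X + κ + (p + s) * δ by ring,
      show X + δ + ((p : ℂ) + s) * δ = X + (p + s + 1) * δ by ring,
      show X + ((p : ℂ) + s) * δ + δ = X + (p + s + 1) * δ by ring,
      show X + ((p : ℂ) + s) * δ + κ - q * δ = X + κ + (p + s - q) * δ by ring,
      show X + ((p : ℂ) + s + 1) * δ - q * δ = X + (p + s - q + 1) * δ by ring,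
      show X + ((p : ℂ) + s) * δ + κ = X + κ + (p + s) * δ by ring]
    generalize (∏ x ∈ range (p + s), br (X + κ + ↑x * δ)) / ∏ x ∈ range (p + s), br (X + δ + ↑x * δ) = A
    simp only [mul_comm _ δ] at *
    field_simp

end telescope

/-- The vector of step counts of the shift attached to an index `(μ, I)`. -/
def stepVec {m r : ℕ} (p : (Fin m → ℕ) × Finset (Fin r)) : Fin m ⊕ Fin r → ℕ :=
  Sum.elim p.1 fun j => if j ∈ p.2 then 1 else 0

/-- The part of the first step vector lying on the strings of total length `stepVec p + stepVec q`
that are not completely determined by that total. -/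
def freeVec {m r : ℕ} (p q : (Fin m → ℕ) × Finset (Fin r)) : Fin m ⊕ Fin r → ℕ :=
  Sum.elim p.1 fun j => if j ∈ p.2 ∧ j ∉ q.2 then 1 else 0

/-- The lengths of the strings attached to a total step vector. -/
def stringLen {m r : ℕ} (v : Fin m ⊕ Fin r → ℕ) : Fin m ⊕ Fin r → ℕ :=
  Sum.elim (fun i => v (Sum.inl i)) fun j => if v (Sum.inr j) = 1 then 1 else 0

/-- The mixed factor of `pairConst`. -/
noncomputable def mixedConst (br : ℂ → ℂ) (δ κ X : ℂ) (n k : ℕ) : ℂ :=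
  if k = 0 then br (X - δ) / br (X + ((n : ℂ) - 1) * δ)
  else if k = 1 then br (X - κ) / br (X + n * δ)
  else br (X - κ) / br (X + κ + n * δ)

/-- The factor of `pairConst` attached to a pair of variables of the second kind. -/
noncomputable def secondConst (br : ℂ → ℂ) (δ κ w : ℂ) (a b : ℕ) : ℂ :=
  if a = 2 ∧ b = 0 then br (w - δ) / br w * (br (w - κ - δ) / br (w - κ))
  else if b < a then br (w - δ) / br w else 1

/-- The part of the product of two successive coefficients that depends only on the total step
vector. -/
noncomputable def pairConst (br : ℂ → ℂ) (δ κ : ℂ) {m r : ℕ} (v : Fin m ⊕ Fin r → ℕ)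
    (x : Fin m → ℂ) (y : Fin r → ℂ) : ℂ :=
  (-1 : ℂ) ^ (∑ j, v (Sum.inr j))
    * (∏ i : Fin m, ∏ j : Fin m,
        if i < j then br (x i - x j + ((v (Sum.inl i) : ℂ) - v (Sum.inl j)) * δ) / br (x i - x j)
        else 1)
    * (∏ i : Fin r, ∏ j : Fin r, secondConst br δ κ (y i - y j) (v (Sum.inr i)) (v (Sum.inr j)))
    * (∏ i : Fin m, ∏ j : Fin m, sfac br δ (x i - x j + κ) (v (Sum.inl i))
        / sfac br δ (x i - x j + δ) (v (Sum.inl i)))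
    * ∏ i : Fin m, ∏ j : Fin r, mixedConst br δ κ (x i - y j) (v (Sum.inl i)) (v (Sum.inr j))

section pair

variable {br : ℂ → ℂ} {δ κ : ℂ}

theorem mixed_mul_mixed (hb : IsBracket br) (X : ℂ) (p s : ℕ) (a b : Prop) [Decidable a]
    [Decidable b] (h : ∀ n e : ℤ, br (X + n * δ + e * κ) ≠ 0) {X' : ℂ}
    (hX' : X' = X + p * δ + (if a then 1 else 0) * κ) :
    (if a then br (X - κ) / br (X + p * δ) else br (X - δ) / br (X + ((p : ℂ) - 1) * δ))
        * (if b then br (X' - κ) / br (X' + s * δ) else br (X' - δ) / br (X' + ((s : ℂ) - 1) * δ))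
      = mixedConst br δ κ X (p + s) ((if a then 1 else 0) + if b then 1 else 0)
        * (strProd br δ κ X p (if a ∧ ¬b then 1 else 0)
            (if (if a then 1 else 0) + (if b then 1 else 0) = 1 then 1 else 0)
          * strProd br δ κ (-X) (if a ∧ ¬b then 1 else 0) p (p + s)) := by
  subst hX'
  have h₁ : ∀ e : ℤ, br (X + e * δ) ≠ 0 := fun e => by simpa using h e 0
  have h₂ : ∀ e : ℤ, br (X + κ + e * δ) ≠ 0 := fun e => by
    convert h e 1 using 2
    push_cast
    ring
  have h₃ : ∀ e : ℤ, br (X - κ + e * δ) ≠ 0 := fun e => by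
    convert h e (-1) using 2
    push_cast
    ring
  by_cases ha : a <;> by_cases hb' : b
  · have h₄ := h₁ p
    push_cast at h₄
    simp only [ha, hb', mixedConst, strProd, if_true, not_true, and_false, if_false]
    simp
    rw [show X + p * δ + κ + s * δ = X + κ + (p + s) * δ by ring]
    simp only [mul_comm _ δ] at *
    field_simp
  · have := prod_Ico_kern hb X p s h₁ h₂
    have h₄ := h₁ p
    have h₅ := h₁ (p + s)
    have h₆ := h₂ (p + s - 1)
    push_cast at h₄ h₅ h₆ this
    simp [ha, hb', mixedConst, strProd]
    simp only [← sub_eq_add_neg]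
    rw [this, show X + p * δ + κ - δ = X + κ + (p - 1) * δ by ring,
      show X + p * δ + κ + (s - 1) * δ = X + κ + (p + s - 1) * δ by ring]
    simp only [mul_comm _ δ] at *
    field_simp
  · have := prod_range_kern (δ := δ) (κ := κ) hb (-X) p (fun e _ => by
      have := h₁ (-e)
      rw [← neg_neg (br _), ← hb.odd, neg_ne_zero]
      convert this using 2
      push_cast
      ring)
      (fun e => by
      have := h₃ (-e)
      rw [← neg_neg (br _), ← hb.odd, neg_ne_zero]
      convert this using 2
      push_cast
      ring)
    have h₄ := h₃ 0
    have h₅ := h₁ (p + s)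
    have h₆ := h₁ (p - 1)
    push_cast at h₄ h₅ h₆
    rw [show -X + δ = -(X - δ) by ring, show -X + κ - p * δ = -(X - κ + p * δ) by ring,
      show -(X - δ) - p * δ = -(X + (p - 1) * δ) by ring, show -X + κ = -(X - κ) by ring,
      hb.odd, hb.odd, hb.odd, hb.odd, neg_mul_neg, neg_mul_neg] at this
    simp [ha, hb', mixedConst, strProd]
    simp only [neg_neg, zero_mul, add_zero] at this h₄
    rw [this, show X + p * δ - κ = X - κ + p * δ by ring,
      show X + p * δ + s * δ = X + (p + s) * δ by ring]
    simp only [mul_comm _ δ] at *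
    field_simp
  · have h₄ := h₁ (p - 1)
    push_cast at h₄
    simp [ha, hb', mixedConst, strProd]
    rw [show X + p * δ + (s - 1) * δ = X + (p + s - 1) * δ by ring,
      show X + p * δ - δ = X + (p - 1) * δ by ring]
    simp only [mul_comm _ δ] at *
    field_simp

theorem div_mul_div_eq_kern (hb : IsBracket br) (w : ℂ) :
    br (w - δ) / br w * (br (κ - w - δ) / br (κ - w)) = kern br δ κ w := by
  unfold kern
  rw [show κ - w - δ = -(w - κ + δ) by ring, show κ - w = -(w - κ) by ring, hb.odd, hb.odd,
    neg_div_neg_eq, div_mul_div_comm]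

theorem second_mul_second (w : ℂ) {w' : ℂ} (a b a' b' : Prop) [Decidable a] [Decidable b]
    [Decidable a'] [Decidable b']
    (hw' : w' = w - κ * (if a then 1 else 0) + κ * (if a' then 1 else 0)) :
    (if a ∧ ¬a' then br (w - δ) / br w else 1) * (if b ∧ ¬b' then br (w' - δ) / br w' else 1)
      = secondConst br δ κ w ((if a then 1 else 0) + if b then 1 else 0)
          ((if a' then 1 else 0) + if b' then 1 else 0)
        * ((if (a ∧ ¬b) ∧ (b' ∧ ¬a') then br (w - δ) / br w else 1)
          * if (a' ∧ ¬b') ∧ (b ∧ ¬a) then br (κ + w - δ) / br (κ + w) else 1) := by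
  subst hw'
  by_cases ha : a <;> by_cases hb : b <;> by_cases ha' : a' <;> by_cases hb' : b' <;>
    simp [ha, hb, ha', hb', secondConst, add_comm]

theorem prod_second_mul {r : ℕ} (hb : IsBracket br) (y : Fin r → ℂ) (I J : Finset (Fin r)) :
    (∏ i ∈ I, ∏ j ∈ Iᶜ, br (y i - y j - δ) / br (y i - y j))
        * (∏ i ∈ J, ∏ j ∈ Jᶜ, br (yshift κ I y i - yshift κ I y j - δ)
          / br (yshift κ I y i - yshift κ I y j))
      = (∏ i, ∏ j, secondConst br δ κ (y i - y j) ((if i ∈ I then 1 else 0) + if i ∈ J then 1 else 0)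
          ((if j ∈ I then 1 else 0) + if j ∈ J then 1 else 0))
        * ∏ i, ∏ j, strProd br δ κ (y i - y j) (if i ∈ I ∧ i ∉ J then 1 else 0)
          (if j ∈ I ∧ j ∉ J then 1 else 0)
          (if (if j ∈ I then 1 else 0) + (if j ∈ J then 1 else 0) = 1 then 1 else 0) := by
  have expand : ∀ (I : Finset (Fin r)) (g : Fin r → Fin r → ℂ),
      ∏ i ∈ I, ∏ j ∈ Iᶜ, g i j = ∏ i, ∏ j, if i ∈ I ∧ j ∉ I then g i j else 1 := by
    intro I g
    rw [← Fintype.prod_ite_mem I]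
    refine prod_congr rfl fun i _ => ?_
    by_cases hi : i ∈ I
    · rw [if_pos hi, ← Fintype.prod_ite_mem Iᶜ]
      simp [hi]
    · simp [hi]
  rw [expand, expand, ← prod_mul_distrib]
  simp only [← prod_mul_distrib]
  have step : ∀ i j, _ := fun i j => second_mul_second (br := br) (δ := δ) (κ := κ) (y i - y j)
    (w' := yshift κ I y i - yshift κ I y j) (i ∈ I) (i ∈ J) (j ∈ I) (j ∈ J)
    (by simp only [yshift]; ring)
  simp only [step, prod_mul_distrib]
  congr 1
  rw [prod_comm (f := fun i j => if (j ∈ I ∧ j ∉ J) ∧ i ∈ J ∧ i ∉ I then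
    br (κ + (y i - y j) - δ) / br (κ + (y i - y j)) else 1), ← prod_mul_distrib]
  refine prod_congr rfl fun i _ => ?_
  rw [← prod_mul_distrib]
  refine prod_congr rfl fun j _ => ?_
  have hk := div_mul_div_eq_kern (δ := δ) (κ := κ) hb (y i - y j)
  rw [show κ - (y i - y j) = κ + (y j - y i) by ring] at hk
  by_cases hiI : i ∈ I <;> by_cases hiJ : i ∈ J <;> by_cases hjI : j ∈ I <;>
    by_cases hjJ : j ∈ J <;> simp [strProd, hiI, hiJ, hjI, hjJ, hk]

end pair

section coef

variable {br : ℂ → ℂ} {δ κ : ℂ} {m r : ℕ}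

theorem prod_vandermonde_mul (x : Fin m → ℂ) (μ ν : Fin m → ℕ)
    (hx : ∀ i j, i ≠ j → ∀ n : ℤ, br (x i - x j + n * δ) ≠ 0) :
    (∏ i, ∏ j, if i < j then br (x i - x j + ((μ i : ℂ) - μ j) * δ) / br (x i - x j) else 1)
        * (∏ i, ∏ j, if i < j then
          br (xshift δ μ x i - xshift δ μ x j + ((ν i : ℂ) - ν j) * δ)
            / br (xshift δ μ x i - xshift δ μ x j) else 1)
      = ∏ i, ∏ j, if i < j then
        br (x i - x j + (((μ i + ν i : ℕ) : ℂ) - (μ j + ν j : ℕ)) * δ) / br (x i - x j) else 1 := by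
  rw [← prod_mul_distrib]
  refine prod_congr rfl fun i _ => ?_
  rw [← prod_mul_distrib]
  refine prod_congr rfl fun j _ => ?_
  split_ifs with hij
  · have h := hx i j hij.ne (μ i - μ j)
    push_cast at h ⊢
    rw [show xshift δ μ x i - xshift δ μ x j = x i - x j + ((μ i : ℂ) - μ j) * δ by
        simp only [xshift]; ring,
      show x i - x j + ((μ i : ℂ) - μ j) * δ + ((ν i : ℂ) - ν j) * δ
        = x i - x j + ((μ i : ℂ) + ν i - (μ j + ν j)) * δ by ring, mul_comm, div_mul_div_cancel₀ h]
  · rw [mul_one]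

theorem prod_first_mul (hb : IsBracket br) (x : Fin m → ℂ) (μ ν : Fin m → ℕ)
    (hx : ∀ i j, ∀ n : ℤ, (i = j → n ≠ 0) → br (x i - x j + n * δ) ≠ 0)
    (hx' : ∀ i j, ∀ n : ℤ, br (x i - x j + κ + n * δ) ≠ 0) :
    (∏ i, ∏ j, sfac br δ (x i - x j + κ) (μ i) / sfac br δ (x i - x j + δ) (μ i))
        * (∏ i, ∏ j, sfac br δ (xshift δ μ x i - xshift δ μ x j + κ) (ν i)
          / sfac br δ (xshift δ μ x i - xshift δ μ x j + δ) (ν i))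
      = (∏ i, ∏ j, sfac br δ (x i - x j + κ) (μ i + ν i : ℕ)
          / sfac br δ (x i - x j + δ) (μ i + ν i : ℕ))
        * ∏ i, ∏ j, strProd br δ κ (x i - x j) (μ i) (μ j) (μ j + ν j) := by
  rw [prod_comm (f := fun i j => strProd br δ κ (x i - x j) (μ i) (μ j) (μ j + ν j)),
    ← prod_mul_distrib, ← prod_mul_distrib]
  refine prod_congr rfl fun i _ => ?_
  rw [← prod_mul_distrib, ← prod_mul_distrib]
  refine prod_congr rfl fun j _ => ?_
  rw [show xshift δ μ x i - xshift δ μ x j = x i - x j + ((μ i : ℂ) - μ j) * δ by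
    simp only [xshift]; ring, ← neg_sub (x i)]
  refine strProd_eq_sfac hb _ _ _ _ (fun e he => hx i j e ?_) (hx' i j)
    fun e he => hx i j e fun _ => he.ne'
  rintro rfl
  omega

theorem prod_mixed_mul (hb : IsBracket br) (x : Fin m → ℂ) (y : Fin r → ℂ) (μ ν : Fin m → ℕ)
    (I J : Finset (Fin r)) (h : ∀ i j, ∀ n e : ℤ, br (x i - y j + n * δ + e * κ) ≠ 0) :
    (∏ i, ((∏ j ∈ I, br (x i - y j - κ) / br (x i - y j + (μ i : ℂ) * δ))
          * ∏ j ∈ Iᶜ, br (x i - y j - δ) / br (x i - y j + ((μ i : ℂ) - 1) * δ)))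
        * (∏ i, ((∏ j ∈ J, br (xshift δ μ x i - yshift κ I y j - κ)
            / br (xshift δ μ x i - yshift κ I y j + (ν i : ℂ) * δ))
          * ∏ j ∈ Jᶜ, br (xshift δ μ x i - yshift κ I y j - δ)
            / br (xshift δ μ x i - yshift κ I y j + ((ν i : ℂ) - 1) * δ)))
      = (∏ i, ∏ j, mixedConst br δ κ (x i - y j) (μ i + ν i)
          ((if j ∈ I then 1 else 0) + if j ∈ J then 1 else 0))
        * ((∏ i, ∏ j, strProd br δ κ (x i - y j) (μ i) (if j ∈ I ∧ j ∉ J then 1 else 0)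
            (if (if j ∈ I then 1 else 0) + (if j ∈ J then 1 else 0) = 1 then 1 else 0))
          * ∏ j, ∏ i, strProd br δ κ (y j - x i) (if j ∈ I ∧ j ∉ J then 1 else 0) (μ i)
            (μ i + ν i)) := by
  have merge : ∀ (I : Finset (Fin r)) (f g : Fin r → ℂ),
      (∏ j ∈ I, f j) * ∏ j ∈ Iᶜ, g j = ∏ j, if j ∈ I then f j else g j := by
    intro I f g
    rw [prod_ite, filter_mem_eq_inter, univ_inter]
    congr 2
    ext
    simp
  simp only [merge]
  rw [prod_comm (f := fun j i => strProd br δ κ (y j - x i) (if j ∈ I ∧ j ∉ J then 1 else 0) (μ i)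
    (μ i + ν i))]
  simp only [← prod_mul_distrib]
  refine prod_congr rfl fun i _ => prod_congr rfl fun j _ => ?_
  rw [← neg_sub (x i) (y j)]
  refine mixed_mul_mixed hb _ _ _ _ _ (h i j) ?_
  simp only [xshift, yshift]
  ring

theorem Coef_mul_Coef (hb : IsBracket br) (x : Fin m → ℂ) (y : Fin r → ℂ)
    (hw : ∀ c d, ∀ n e : ℤ, (c = d → n = 0 → e ≠ 0) →
      br (Sum.elim x y c - Sum.elim x y d + n * δ + e * κ) ≠ 0)
    (p q : (Fin m → ℕ) × Finset (Fin r)) :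
    Coef br δ κ p.1 p.2 x y * Coef br δ κ q.1 q.2 (xshift δ p.1 x) (yshift κ p.2 y)
      = pairConst br δ κ (stepVec p + stepVec q) x y
        * ∏ c, ∏ d, strProd br δ κ (Sum.elim x y c - Sum.elim x y d) (freeVec p q c)
          (freeVec p q d) (stringLen (stepVec p + stepVec q) d) := by
  obtain ⟨μ, I⟩ := p
  obtain ⟨ν, J⟩ := q
  have hV := prod_vandermonde_mul (br := br) (δ := δ) x μ ν fun i j hij n => by
    simpa using hw (Sum.inl i) (Sum.inl j) n 0 fun h => absurd (Sum.inl_injective h) hij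
  have hS := prod_second_mul (δ := δ) (κ := κ) hb y I J
  have hF := prod_first_mul (δ := δ) (κ := κ) hb x μ ν (fun i j n hn => by
    simpa using hw (Sum.inl i) (Sum.inl j) n 0 fun h h' => absurd h' (hn (Sum.inl_injective h)))
    (fun i j n => by
      convert hw (Sum.inl i) (Sum.inl j) n 1 (by simp) using 2
      simp only [Sum.elim_inl]
      push_cast
      ring)
  have hM := prod_mixed_mul (δ := δ) (κ := κ) hb x y μ ν I J fun i j n e => by
    simpa using hw (Sum.inl i) (Sum.inr j) n e (by simp)
  have hsign : (-1 : ℂ) ^ (∑ j, ((if j ∈ I then 1 else 0) + if j ∈ J then 1 else 0))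
      = (-1) ^ I.card * (-1) ^ J.card := by
    rw [← pow_add, sum_add_distrib]
    simp
  have hL : stringLen (stepVec (μ, I) + stepVec (ν, J)) = Sum.elim (fun i => μ i + ν i) fun j =>
      if (if j ∈ I then 1 else 0) + (if j ∈ J then 1 else 0) = 1 then 1 else 0 := rfl
  rw [hL]
  simp only [Coef, pairConst, stepVec, freeVec, Pi.add_apply, Sum.elim_inl, Sum.elim_inr,
    Fintype.prod_sum_type, prod_mul_distrib]
  simp only [prod_mul_distrib] at hM
  rw [hsign]
  linear_combination (-1) ^ I.card * (-1) ^ J.card * congr($hV * $hS * $hF * $hM)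

end coef

section fiber

variable {br : ℂ → ℂ} {δ κ : ℂ} {m r : ℕ}

theorem sum_stepVec (p : (Fin m → ℕ) × Finset (Fin r)) :
    ∑ c, stepVec p c = ∑ i, p.1 i + p.2.card := by
  simp [stepVec, Fintype.sum_sum_type]

theorem mem_idxSet {k : ℕ} {p : (Fin m → ℕ) × Finset (Fin r)} :
    p ∈ idxSet m r k ↔ ∑ c, stepVec p c = k := by
  rw [sum_stepVec, idxSet, mem_filter, mem_product, Fintype.mem_piFinset, and_iff_right_iff_imp]
  intro h
  refine ⟨fun i => mem_range.mpr ?_, mem_univ _⟩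
  have := single_le_sum (fun j _ => Nat.zero_le (p.1 j)) (mem_univ i)
  omega

/-- The pairs of indices of degrees `k` and `l` with a given total step vector. -/
def stepFiber {m r : ℕ} (k l : ℕ) (v : Fin m ⊕ Fin r → ℕ) :
    Finset (((Fin m → ℕ) × Finset (Fin r)) × ((Fin m → ℕ) × Finset (Fin r))) :=
  (idxSet m r k ×ˢ idxSet m r l).filter fun s => stepVec s.1 + stepVec s.2 = v

theorem mem_stepFiber {k l : ℕ} {v : Fin m ⊕ Fin r → ℕ}
    {s : ((Fin m → ℕ) × Finset (Fin r)) × ((Fin m → ℕ) × Finset (Fin r))} :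
    s ∈ stepFiber k l v ↔ (∑ c, stepVec s.1 c = k ∧ ∑ c, stepVec s.2 c = l)
      ∧ stepVec s.1 + stepVec s.2 = v := by
  rw [stepFiber, mem_filter, mem_product, mem_idxSet, mem_idxSet]

/-- The first index of the pair with total step vector `v` and free part `M`. -/
def firstIdx (v M : Fin m ⊕ Fin r → ℕ) : (Fin m → ℕ) × Finset (Fin r) :=
  (fun i => M (Sum.inl i), univ.filter fun j => v (Sum.inr j) = 2 ∨ M (Sum.inr j) = 1)

/-- The second index of the pair with total step vector `v` and free part `M`. -/
def secondIdx (v M : Fin m ⊕ Fin r → ℕ) : (Fin m → ℕ) × Finset (Fin r) :=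
  (fun i => v (Sum.inl i) - M (Sum.inl i),
    univ.filter fun j => v (Sum.inr j) = 2 ∨ v (Sum.inr j) = 1 ∧ M (Sum.inr j) = 0)

theorem freeVec_le (p q : (Fin m → ℕ) × Finset (Fin r)) (c : Fin m ⊕ Fin r) :
    freeVec p q c ≤ stringLen (stepVec p + stepVec q) c := by
  rcases c with i | j
  · simp [freeVec, stringLen, stepVec]
  · by_cases h₁ : j ∈ p.2 <;> by_cases h₂ : j ∈ q.2 <;> simp [freeVec, stringLen, stepVec, h₁, h₂]

theorem sum_stepVec_eq_sum_freeVec (p q : (Fin m → ℕ) × Finset (Fin r)) :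
    ∑ c, stepVec p c
      = ∑ c, freeVec p q c
        + (univ.filter fun j => (stepVec p + stepVec q) (Sum.inr j) = 2).card := by
  rw [card_filter, Fintype.sum_sum_type, Fintype.sum_sum_type, add_assoc, ← sum_add_distrib]
  congr 1
  refine sum_congr rfl fun j _ => ?_
  by_cases h₁ : j ∈ p.2 <;> by_cases h₂ : j ∈ q.2 <;> simp [freeVec, stepVec, h₁, h₂]

theorem sum_eq_sum_stringLen {v : Fin m ⊕ Fin r → ℕ} (hv : ∀ j, v (Sum.inr j) ≤ 2) :
    ∑ c, v c = ∑ c, stringLen v c + 2 * (univ.filter fun j => v (Sum.inr j) = 2).card := by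
  rw [card_filter, Fintype.sum_sum_type, Fintype.sum_sum_type, add_assoc, mul_sum,
    ← sum_add_distrib]
  congr 1
  refine sum_congr rfl fun j _ => ?_
  have := hv j
  simp only [stringLen, Sum.elim_inr]
  split_ifs <;> omega

theorem stepVec_firstIdx_add_secondIdx {v M : Fin m ⊕ Fin r → ℕ} (hv : ∀ j, v (Sum.inr j) ≤ 2)
    (hM : ∀ c, M c ≤ stringLen v c) : stepVec (firstIdx v M) + stepVec (secondIdx v M) = v := by
  ext (i | j)
  · have := hM (Sum.inl i)
    simp only [stringLen, Sum.elim_inl] at this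
    simp only [stepVec, firstIdx, secondIdx, Pi.add_apply, Sum.elim_inl]
    omega
  · have h₁ := hM (Sum.inr j)
    have h₂ := hv j
    simp only [stringLen, Sum.elim_inr] at h₁
    simp only [stepVec, firstIdx, secondIdx, Pi.add_apply, Sum.elim_inr, mem_filter, mem_univ,
      true_and]
    split_ifs at * <;> omega

theorem freeVec_firstIdx_secondIdx {v M : Fin m ⊕ Fin r → ℕ} (hM : ∀ c, M c ≤ stringLen v c) :
    freeVec (firstIdx v M) (secondIdx v M) = M := by
  ext (i | j)
  · simp [freeVec, firstIdx]
  · have := hM (Sum.inr j)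
    simp only [stringLen, Sum.elim_inr] at this
    simp only [freeVec, firstIdx, secondIdx, Sum.elim_inr, mem_filter, mem_univ, true_and]
    split_ifs at * <;> omega

theorem firstIdx_freeVec (p q : (Fin m → ℕ) × Finset (Fin r)) :
    firstIdx (stepVec p + stepVec q) (freeVec p q) = p := by
  refine Prod.ext rfl (Finset.ext fun j => ?_)
  by_cases h₁ : j ∈ p.2 <;> by_cases h₂ : j ∈ q.2 <;>
    simp [firstIdx, freeVec, stepVec, h₁, h₂]

theorem secondIdx_freeVec (p q : (Fin m → ℕ) × Finset (Fin r)) :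
    secondIdx (stepVec p + stepVec q) (freeVec p q) = q := by
  refine Prod.ext (funext fun i => ?_) (Finset.ext fun j => ?_)
  · simp [secondIdx, freeVec, stepVec]
  · by_cases h₁ : j ∈ p.2 <;> by_cases h₂ : j ∈ q.2 <;>
      simp [secondIdx, freeVec, stepVec, h₁, h₂]

theorem sum_stepFiber {k l : ℕ} {v : Fin m ⊕ Fin r → ℕ} (hv : ∀ j, v (Sum.inr j) ≤ 2)
    (hkl : ∑ c, v c = k + l) (G : (Fin m ⊕ Fin r → ℕ) → ℂ) :
    ∑ s ∈ stepFiber k l v, G (freeVec s.1 s.2)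
      = ∑ M ∈ Fintype.piFinset fun c => range (stringLen v c + 1),
        (if ∑ c, M c + (univ.filter fun j => v (Sum.inr j) = 2).card = k then 1 else 0) * G M := by
  simp only [ite_mul, one_mul, zero_mul]
  rw [← sum_filter]
  have hmem : ∀ M, M ∈ (Fintype.piFinset fun c => range (stringLen v c + 1)) ↔
      ∀ c, M c ≤ stringLen v c := by
    simp
  refine sum_nbij' (fun s => freeVec s.1 s.2) (fun M => (firstIdx v M, secondIdx v M)) ?_ ?_ ?_ ?_
    fun _ _ => rfl
  · rintro ⟨p, q⟩ hs
    obtain ⟨⟨rfl, -⟩, rfl⟩ := mem_stepFiber.mp hs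
    exact mem_filter.mpr ⟨(hmem _).mpr (freeVec_le p q), (sum_stepVec_eq_sum_freeVec p q).symm⟩
  · intro M hM
    obtain ⟨hM, hk⟩ := mem_filter.mp hM
    rw [hmem] at hM
    have hadd := stepVec_firstIdx_add_secondIdx hv hM
    have hfirst : ∑ c, stepVec (firstIdx v M) c = k := by
      rw [sum_stepVec_eq_sum_freeVec _ (secondIdx v M), hadd, freeVec_firstIdx_secondIdx hM, hk]
    refine mem_stepFiber.mpr ⟨⟨hfirst, ?_⟩, hadd⟩
    have := congrArg (fun u : Fin m ⊕ Fin r → ℕ => ∑ c, u c) hadd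
    simp only [Pi.add_apply, sum_add_distrib] at this
    simp only
    omega
  · rintro ⟨p, q⟩ hs
    obtain ⟨-, rfl⟩ := mem_stepFiber.mp hs
    exact Prod.ext (firstIdx_freeVec p q) (secondIdx_freeVec p q)
  · intro M hM
    exact freeVec_firstIdx_secondIdx ((hmem _).mp (mem_filter.mp hM).1)

/-- The product of the coefficients of two successive shifts. -/
noncomputable def pairCoef (br : ℂ → ℂ) (δ κ : ℂ) {m r : ℕ}
    (s : ((Fin m → ℕ) × Finset (Fin r)) × ((Fin m → ℕ) × Finset (Fin r))) (x : Fin m → ℂ)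
    (y : Fin r → ℂ) : ℂ :=
  Coef br δ κ s.1.1 s.1.2 x y * Coef br δ κ s.2.1 s.2.2 (xshift δ s.1.1 x) (yshift κ s.1.2 y)

theorem sum_pairCoef_comm_of_generic (hb : IsBracket br) (hκ : ∀ e : ℤ, e ≠ 0 → br (e * κ) ≠ 0)
    (x : Fin m → ℂ) (y : Fin r → ℂ)
    (hw : ∀ c d, ∀ n e : ℤ, (c = d → n = 0 → e ≠ 0) →
      br (Sum.elim x y c - Sum.elim x y d + n * δ + e * κ) ≠ 0)
    (k l : ℕ) (v : Fin m ⊕ Fin r → ℕ) :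
    ∑ s ∈ stepFiber k l v, pairCoef br δ κ s x y
      = ∑ s ∈ stepFiber l k v, pairCoef br δ κ s x y := by
  by_cases h : (∀ j, v (Sum.inr j) ≤ 2) ∧ ∑ c, v c = k + l
  · obtain ⟨hv, hkl⟩ := h
    have key : ∀ k l, ∑ c, v c = k + l → ∑ s ∈ stepFiber k l v, pairCoef br δ κ s x y
        = pairConst br δ κ v x y * ∑ M ∈ Fintype.piFinset fun c => range (stringLen v c + 1),
          (if ∑ c, M c + (univ.filter fun j => v (Sum.inr j) = 2).card = k then 1 else 0)
            * ∏ c, ∏ d, strProd br δ κ (Sum.elim x y c - Sum.elim x y d) (M c) (M d)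
              (stringLen v d) := by
      intro k l hkl
      rw [← sum_stepFiber hv hkl, mul_sum]
      refine sum_congr rfl fun s hs => ?_
      obtain ⟨-, rfl⟩ := mem_stepFiber.mp hs
      exact Coef_mul_Coef hb x y hw s.1 s.2
    rw [key k l hkl, key l k (by omega)]
    congr 1
    rw [strings_exchange hb hκ _ hw (stringLen v) fun n =>
      if n + (univ.filter fun j => v (Sum.inr j) = 2).card = k then 1 else 0]
    refine sum_congr rfl fun M hM => ?_
    congr 1
    have hle : ∑ c, M c ≤ ∑ c, stringLen v c := sum_le_sum fun c _ => by
      simpa [Nat.lt_succ_iff] using Fintype.mem_piFinset.mp hM c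
    have := sum_eq_sum_stringLen hv
    refine if_congr ?_ rfl rfl
    omega
  · have empty : ∀ k' l', k' + l' = k + l → stepFiber k' l' v = ∅ := by
      intro k' l' hkl
      refine eq_empty_of_forall_notMem fun s hs => h ?_
      obtain ⟨⟨h₁, h₂⟩, rfl⟩ := mem_stepFiber.mp hs
      constructor
      · intro j
        simp only [Pi.add_apply, stepVec, Sum.elim_inr]
        split_ifs <;> omega
      · simp only [Pi.add_apply, sum_add_distrib]
        omega
    rw [empty k l rfl, empty l k (add_comm _ _)]

end fiber

section perturb

variable {br : ℂ → ℂ} {δ κ : ℂ} {m r : ℕ}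

theorem continuousAt_Coef (hb : IsBracket br) (μ : Fin m → ℕ) (I : Finset (Fin r)) {κ : ℂ → ℂ}
    {x : ℂ → Fin m → ℂ} {y : ℂ → Fin r → ℂ} {t₀ : ℂ} (hκ : ContinuousAt κ t₀)
    (hx : ∀ i, ContinuousAt (fun t => x t i) t₀) (hy : ∀ j, ContinuousAt (fun t => y t j) t₀)
    (h : CDenomNZ br δ μ I (x t₀) (y t₀)) :
    ContinuousAt (fun t => Coef br δ (κ t) μ I (x t) (y t)) t₀ := by
  obtain ⟨h₁, h₂, h₃, h₄, h₅⟩ := h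
  have hbr : ∀ {g : ℂ → ℂ}, ContinuousAt g t₀ → ContinuousAt (fun t => br (g t)) t₀ :=
    fun hg => ContinuousAt.comp' hb.diff.continuous.continuousAt hg
  have hprod : ∀ {ι : Type} (s : Finset ι) {g : ι → ℂ → ℂ}, (∀ i ∈ s, ContinuousAt (g i) t₀) →
      ContinuousAt (fun t => ∏ i ∈ s, g i t) t₀ := fun s _ hg => tendsto_finsetProd s hg
  simp only [sfac_natCast] at h₃
  simp only [Coef, sfac_natCast]
  have hxx : ∀ i j, ContinuousAt (fun t => x t i - x t j) t₀ := fun i j => (hx i).sub (hx j)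
  have hyy : ∀ i j, ContinuousAt (fun t => y t i - y t j) t₀ := fun i j => (hy i).sub (hy j)
  have hxy : ∀ i j, ContinuousAt (fun t => x t i - y t j) t₀ := fun i j => (hx i).sub (hy j)
  refine ((((continuousAt_const).mul (hprod _ fun i _ => hprod _ fun j _ => ?_)).mul
    (hprod _ fun i hi => hprod _ fun j hj => ?_)).mul
    (hprod _ fun i _ => hprod _ fun j _ => ?_)).mul (hprod _ fun i _ =>
    (hprod _ fun j hj => ?_).mul (hprod _ fun j hj => ?_))
  · split_ifs with hij
    · exact (hbr ((hxx i j).add continuousAt_const)).div (hbr (hxx i j)) (h₁ i j hij)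
    · exact continuousAt_const
  · exact (hbr ((hyy i j).sub continuousAt_const)).div (hbr (hyy i j)) (h₂ i hi j hj)
  · exact (hprod _ fun a _ => hbr (((hxx i j).add hκ).add continuousAt_const)).div
      (hprod _ fun a _ => hbr (((hxx i j).add continuousAt_const).add continuousAt_const)) (h₃ i j)
  · exact (hbr ((hxy i j).sub hκ)).div (hbr ((hxy i j).add continuousAt_const)) (h₄ i j hj)
  · exact (hbr ((hxy i j).sub continuousAt_const)).div (hbr ((hxy i j).add continuousAt_const))
      (h₅ i j hj)

theorem eventually_generic (hb : IsBracket br) (hδ : ∀ n : ℕ, 1 ≤ n → br ((n : ℂ) * δ) ≠ 0)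
    {ι : Type*} [Countable ι] (w : ι → ℂ) (u : ι → ℕ) (hu : Function.Injective u) :
    ∀ᶠ t in residual ℂ, (∀ e : ℤ, e ≠ 0 → br (e * (κ + t)) ≠ 0) ∧
      ∀ c d, ∀ n e : ℤ, (c = d → n = 0 → e ≠ 0) →
        br (w c + t * (u c * Complex.I) - (w d + t * (u d * Complex.I)) + n * δ + e * (κ + t))
          ≠ 0 := by
  refine Filter.Eventually.and ?_ ?_
  · refine eventually_countable_forall.mpr fun e => Filter.eventually_imp_distrib_left.mpr fun he => ?_
    filter_upwards [hb.eventually_ne (e * κ) (β := e) (by exact_mod_cast he)] with t ht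
    convert ht using 2
    ring
  · simp only [eventually_countable_forall]
    intro c d n e hne
    by_cases hce : c = d ∧ e = 0
    · obtain ⟨rfl, rfl⟩ := hce
      have hn : n ≠ 0 := fun hn => hne rfl hn rfl
      refine Filter.Eventually.of_forall fun t => ?_
      simp only [sub_self, zero_add, Int.cast_zero, zero_mul, add_zero]
      rcases Int.natAbs_eq n with h | h
      · rw [h, Int.cast_natCast]
        exact hδ _ (by omega)
      · rw [h, Int.cast_neg, neg_mul, hb.odd, neg_ne_zero, Int.cast_natCast]
        exact hδ _ (by omega)
    · have hslope : ((u c : ℂ) - u d) * Complex.I + e ≠ 0 := by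
        intro h
        have hre := congrArg Complex.re h
        have him := congrArg Complex.im h
        simp at hre him
        exact hce ⟨hu (by exact_mod_cast sub_eq_zero.mp him), hre⟩
      filter_upwards [hb.eventually_ne (w c - w d + n * δ + e * κ) hslope] with t ht
      convert ht using 2
      ring

theorem eq_of_eventually_residual {f g : ℂ → ℂ} {t₀ : ℂ} (hf : ContinuousAt f t₀)
    (hg : ContinuousAt g t₀) (h : ∀ᶠ t in residual ℂ, f t = g t) : f t₀ = g t₀ := by
  by_contra hne
  have hfreq := mem_closure_iff_frequently.mp (dense_of_mem_residual h t₀)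
  obtain ⟨t, ht, ht'⟩ := (hfreq.and_eventually ((hf.prodMk hg).eventually
    (isOpen_ne_fun continuous_fst continuous_snd |>.mem_nhds hne))).exists
  exact ht' ht

theorem sum_pairCoef_comm (hb : IsBracket br) (hδ : ∀ n : ℕ, 1 ≤ n → br ((n : ℂ) * δ) ≠ 0)
    {k l : ℕ} {x : Fin m → ℂ} {y : Fin r → ℂ}
    (h1 : ∀ p ∈ idxSet m r k, CDenomNZ br δ p.1 p.2 x y)
    (h2 : ∀ p ∈ idxSet m r l, CDenomNZ br δ p.1 p.2 x y)
    (h3 : ∀ p ∈ idxSet m r k, ∀ q ∈ idxSet m r l,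
      CDenomNZ br δ q.1 q.2 (xshift δ p.1 x) (yshift κ p.2 y))
    (h4 : ∀ p ∈ idxSet m r l, ∀ q ∈ idxSet m r k,
      CDenomNZ br δ q.1 q.2 (xshift δ p.1 x) (yshift κ p.2 y)) (v : Fin m ⊕ Fin r → ℕ) :
    ∑ s ∈ stepFiber k l v, pairCoef br δ κ s x y
      = ∑ s ∈ stepFiber l k v, pairCoef br δ κ s x y := by
  let u : Fin m ⊕ Fin r → ℕ := fun c => finSumFinEquiv c
  have hu : Function.Injective u := Fin.val_injective.comp finSumFinEquiv.injective
  let X : ℂ → Fin m → ℂ := fun t i => x i + t * (u (Sum.inl i) * Complex.I)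
  let Y : ℂ → Fin r → ℂ := fun t j => y j + t * (u (Sum.inr j) * Complex.I)
  have hX : X 0 = x := by simp [X]
  have hY : Y 0 = y := by simp [Y]
  have cont : ∀ k l : ℕ, (∀ p ∈ idxSet m r k, CDenomNZ br δ p.1 p.2 x y) →
      (∀ p ∈ idxSet m r k, ∀ q ∈ idxSet m r l,
        CDenomNZ br δ q.1 q.2 (xshift δ p.1 x) (yshift κ p.2 y)) →
      ContinuousAt (fun t => ∑ s ∈ stepFiber k l v, pairCoef br δ (κ + t) s (X t) (Y t)) 0 := by
    intro k l h h'
    refine tendsto_finsetSum _ fun s hs => ?_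
    obtain ⟨hs₁, hs₂⟩ := mem_product.mp (mem_filter.mp hs).1
    have hκc : ContinuousAt (fun t => κ + t) 0 := by fun_prop
    refine ContinuousAt.mul
      (continuousAt_Coef hb s.1.1 s.1.2 hκc (fun i => by fun_prop) (fun j => by fun_prop) ?_)
      (continuousAt_Coef hb s.2.1 s.2.2 hκc (fun i => by simp only [xshift]; fun_prop)
        (fun j => by simp only [yshift]; fun_prop) ?_)
    · rw [hX, hY]
      exact h _ hs₁
    · simp only [hX, hY, add_zero]
      exact h' _ hs₁ _ hs₂
  have key := eq_of_eventually_residual (cont k l h1 h3) (cont l k h2 h4) (by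
    filter_upwards [eventually_generic (κ := κ) hb hδ (Sum.elim x y) u hu] with t ht
    refine sum_pairCoef_comm_of_generic hb ht.1 (X t) (Y t) ?_ k l v
    have hXY : Sum.elim (X t) (Y t) = fun c => Sum.elim x y c + t * (u c * Complex.I) := by
      ext (i | j) <;> rfl
    rw [hXY]
    exact ht.2)
  simpa only [hX, hY, add_zero] using key

theorem Hop_Hop (k l : ℕ) (F : (Fin m → ℂ) → (Fin r → ℂ) → ℂ) (x : Fin m → ℂ) (y : Fin r → ℂ)
    {T : Finset (Fin m ⊕ Fin r → ℕ)}
    (hT : ∀ s ∈ idxSet m r k ×ˢ idxSet m r l, stepVec s.1 + stepVec s.2 ∈ T) :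
    Hop br δ κ m r k (fun x' y' => Hop br δ κ m r l F x' y') x y
      = ∑ v ∈ T, (∑ s ∈ stepFiber k l v, pairCoef br δ κ s x y)
        * F (fun i => x i + δ * v (Sum.inl i)) fun j => y j - κ * v (Sum.inr j) := by
  simp only [Hop, mul_sum]
  rw [← sum_product', ← sum_fiberwise_of_maps_to hT]
  refine sum_congr rfl fun v _ => ?_
  rw [sum_mul]
  refine sum_congr rfl fun s hs => ?_
  obtain ⟨-, rfl⟩ := mem_filter.mp hs
  rw [pairCoef, mul_assoc]
  congr 3
  · ext i
    simp only [xshift, stepVec, Pi.add_apply, Sum.elim_inl, Nat.cast_add]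
    ring
  · ext j
    simp only [yshift, stepVec, Pi.add_apply, Sum.elim_inr, Nat.cast_add, Nat.cast_ite,
      Nat.cast_one, Nat.cast_zero]
    ring

end perturb

/-- The deformed elliptic Ruijsenaars operators commute:
`H_{m,r}^{(k)} H_{m,r}^{(l)} = H_{m,r}^{(l)} H_{m,r}^{(k)}` at every admissible point. -/
theorem Hop_commute
    (br : ℂ → ℂ) (hodd : ∀ z : ℂ, br (-z) = -br z)
    (hent : Differentiable ℂ br) (hnz : br ≠ 0)
    (hW : ∀ a b c d : ℂ,
      br (a + b) * br (a - b) * br (c + d) * br (c - d)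
        + br (a + d) * br (a - d) * br (b + c) * br (b - c)
        = br (a + c) * br (a - c) * br (b + d) * br (b - d))
    (δ κ : ℂ)
    (hδ : ∀ n : ℕ, 1 ≤ n → br ((n : ℂ) * δ) ≠ 0)
    (hκ : ∀ n : ℕ, 1 ≤ n → br ((n : ℂ) * κ) ≠ 0)
    (m r k l : ℕ) (F : (Fin m → ℂ) → (Fin r → ℂ) → ℂ)
    (x : Fin m → ℂ) (y : Fin r → ℂ)
    (h1 : ∀ p ∈ idxSet m r k, CDenomNZ br δ p.1 p.2 x y)
    (h2 : ∀ p ∈ idxSet m r l, CDenomNZ br δ p.1 p.2 x y)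
    (h3 : ∀ p ∈ idxSet m r k, ∀ q ∈ idxSet m r l,
      CDenomNZ br δ q.1 q.2 (xshift δ p.1 x) (yshift κ p.2 y))
    (h4 : ∀ p ∈ idxSet m r l, ∀ q ∈ idxSet m r k,
      CDenomNZ br δ q.1 q.2 (xshift δ p.1 x) (yshift κ p.2 y)) :
    Hop br δ κ m r k (fun x' y' => Hop br δ κ m r l F x' y') x y
      = Hop br δ κ m r l (fun x' y' => Hop br δ κ m r k F x' y') x y := by

  classical
  have hb : IsBracket br := ⟨hodd, hent, hnz, hW⟩
  let total (s : ((Fin m → ℕ) × Finset (Fin r)) × ((Fin m → ℕ) × Finset (Fin r))) :=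
    stepVec s.1 + stepVec s.2
  let T := (idxSet m r k ×ˢ idxSet m r l).image total ∪ (idxSet m r l ×ˢ idxSet m r k).image total
  rw [Hop_Hop k l F x y (T := T) fun s hs => mem_union_left _ (mem_image_of_mem total hs),
    Hop_Hop l k F x y (T := T) fun s hs => mem_union_right _ (mem_image_of_mem total hs)]
  exact sum_congr rfl fun v _ => by rw [sum_pairCoef_comm hb hδ h1 h2 h3 h4 v]
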